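/- Let V ⊆ V' be an extension of valuation rings containing ℚ (i.e., both are ℚ-algebras), with maximal ideals m of V and m' of V', such that m' = mV' and the Krull dimension of V is 1. Let q be a prime ideal of V' such that q ∩ V = 0 and there is no prime of V' strictly between q and m' (i.e., height(m'/q) = 1). Assume that the extension V ⊆ V'/q has trivial value group extension. Then V' is ind-smooth over V. -/

import Mathlib

universe u v

/-- A ring homomorphism `f : A →+* B` is *ind-smooth* if `B` is a filtered colimit of smooth
`A`-algebras; equivalently (and this is the definition used here), every `A`-algebra homomorphism
`E → B` from a finitely presented `A`-algebra `E` factors through a smooth (i.e. finitely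
presented and formally smooth) `A`-algebra. -/
def RingHom.IsIndSmooth {A : Type u} {B : Type v} [CommRing A] [CommRing B]
    (f : A →+* B) : Prop :=
  ∀ (E : Type u) [CommRing E] [Algebra A E], Algebra.FinitePresentation A E →
    ∀ w : E →+* B, w.comp (algebraMap A E) = f →
      ∃ (S : Type u) (_ : CommRing S) (_ : Algebra A S), Algebra.Smooth A S ∧
        ∃ (g : E →ₐ[A] S) (h : S →+* B),
          h.comp g.toRingHom = w ∧ h.comp (algebraMap A S) = f

/-- The value group extension of an extension `f : V → V'` of valuation rings is *trivial* if
every nonzero element `x/y` of the fraction field of `V'` is, up to a unit of `V'`, of the form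
`a/b` with `a, b` nonzero in `V`. -/
def RingHom.HasTrivialValueGroupExt {V : Type u} {V' : Type v} [CommRing V] [CommRing V']
    (f : V →+* V') : Prop :=
  ∀ x y : V', x ≠ 0 → y ≠ 0 → ∃ a b : V, a ≠ 0 ∧ b ≠ 0 ∧ Associated (x * f b) (y * f a)

open MvPolynomial in
/-- System form of ind-smoothness: every finite polynomial system over `A` with a solution in `B`
already has that solution coming from a smooth `A`-algebra mapping to `B`. -/
def RingHom.IndSm {A B : Type v} [CommRing A] [CommRing B] (f : A →+* B) : Prop :=
  ∀ (n : ℕ) (x : Fin n → B) (R : Finset (MvPolynomial (Fin n) A)),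
    (∀ r ∈ R, eval₂ f x r = 0) →
    ∃ (S : Type v) (_ : CommRing S) (_ : Algebra A S) (h : S →+* B) (y : Fin n → S),
      Algebra.Smooth A S ∧ h.comp (algebraMap A S) = f ∧ (∀ i, h (y i) = x i) ∧
      ∀ r ∈ R, eval₂ (algebraMap A S) y r = 0

namespace RingHom

open MvPolynomial TensorProduct

theorem IndSm.factor {A B : Type v} [CommRing A] [CommRing B] {f : A →+* B} (hf : f.IndSm)
    {E : Type u} [CommRing E] [Algebra A E] [Algebra.FinitePresentation A E] (w : E →+* B)
    (hw : w.comp (algebraMap A E) = f) :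
    ∃ (S : Type v) (_ : CommRing S) (_ : Algebra A S) (h : S →+* B) (g : E →ₐ[A] S),
      Algebra.Smooth A S ∧ h.comp (algebraMap A S) = f ∧ h.comp g.toRingHom = w := by
  obtain ⟨n, π, hπ, R, hR⟩ := Algebra.FinitePresentation.out (R := A) (A := E)
  have hev : ∀ p : MvPolynomial (Fin n) A, eval₂ f (fun i => w (π (X i))) p = w (π p) := by
    intro p
    have : (eval₂Hom f (fun i => w (π (X i)))) = w.comp π.toRingHom := by
      ext a
      · simp [← hw]
      · simp
    exact congr($this p)
  obtain ⟨S, _, _, h, y, hS, hA, hy, hr⟩ := hf n (fun i => w (π (X i))) R (by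
    intro r hr
    have : r ∈ RingHom.ker π.toRingHom := hR ▸ Ideal.subset_span hr
    have h0 : π r = 0 := this
    rw [hev, h0, map_zero])
  have hker : ∀ p : MvPolynomial (Fin n) A, π p = 0 → aeval (R := A) y p = 0 := by
    intro p hp
    have hle : RingHom.ker π.toRingHom ≤ RingHom.ker (aeval (R := A) y).toRingHom := by
      rw [← hR, Ideal.span_le]
      intro r hr'
      exact hr r hr'
    exact hle (show p ∈ RingHom.ker π.toRingHom from hp)
  refine ⟨S, _, _, h, AlgHom.liftOfSurjective π hπ (aeval y) (fun p hp => hker p hp), hS, hA, ?_⟩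
  ext e
  obtain ⟨p, rfl⟩ := hπ e
  have hl : AlgHom.liftOfSurjective π hπ (aeval y) (fun p hp => hker p hp) (π p) = aeval y p :=
    AlgHom.liftOfSurjective_apply ..
  change h (AlgHom.liftOfSurjective π hπ (aeval y) _ (π p)) = _
  rw [hl, ← hev, aeval_def]
  rw [hom_eval₂, hA]
  congr 1
  ext i
  exact hy i

theorem exists_finitePresentation_of_fg {A B : Type v} [CommRing A] [CommRing B] (f : A →+* B)
    (A₀ : Subalgebra ℤ B) (hA₀ : A₀.FG) (t : Finset B) :
    ∃ (E : Type v) (_ : CommRing E) (_ : Algebra A E) (j : A₀ →+* E) (w : E →+* B),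
      Algebra.FinitePresentation A E ∧ w.comp (algebraMap A E) = f ∧
      w.comp j = A₀.val.toRingHom ∧ ∀ b ∈ t, b ∈ w.range := by
  let := f.toAlgebra
  have : Algebra.FiniteType ℤ A₀ := (Subalgebra.fg_iff_finiteType A₀).mp hA₀
  have : Algebra.FinitePresentation ℤ A₀ := Algebra.FinitePresentation.of_finiteType.mp ‹_›
  let w₀ : A ⊗[ℤ] A₀ →ₐ[A] B := Algebra.TensorProduct.lift (Algebra.ofId A B) A₀.val
    (fun _ _ => Commute.all _ _)
  let w : MvPolynomial t (A ⊗[ℤ] A₀) →+* B := eval₂Hom w₀.toRingHom (fun b => b.1)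
  refine ⟨MvPolynomial t (A ⊗[ℤ] A₀), inferInstance, inferInstance,
    (C : (A ⊗[ℤ] A₀) →+* _).comp Algebra.TensorProduct.includeRight.toRingHom, w,
    Algebra.FinitePresentation.mvPolynomial _ _ _, ?_, ?_, ?_⟩
  · ext a
    rw [RingHom.comp_apply,
      IsScalarTower.algebraMap_apply A (A ⊗[ℤ] A₀) (MvPolynomial t (A ⊗[ℤ] A₀))]
    simp [w, w₀, MvPolynomial.algebraMap_eq]
    rfl
  · ext a
    simp [w, w₀]
  · intro b hb
    exact ⟨X ⟨b, hb⟩, by simp [w]⟩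

theorem exists_finset_mem_range_map {A₀ : Type*} {B B₀ : Type*} [CommRing A₀] [CommRing B]
    [CommRing B₀] [Algebra A₀ B] [Algebra A₀ B₀] (x : B ⊗[A₀] B₀) :
    ∃ t : Finset B, ∀ (E : Type v) [CommRing E] [Algebra A₀ E] (w : E →ₐ[A₀] B),
      (∀ b ∈ t, b ∈ w.range) → ∃ y, Algebra.TensorProduct.map w (AlgHom.id A₀ B₀) y = x := by
  classical
  induction x using TensorProduct.induction_on with
  | zero => exact ⟨∅, fun E _ _ w _ => ⟨0, map_zero _⟩⟩
  | tmul b β =>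
    refine ⟨{b}, fun E _ _ w h => ?_⟩
    obtain ⟨e, rfl⟩ := h b (by simp)
    exact ⟨e ⊗ₜ β, by simp⟩
  | add x y hx hy =>
    obtain ⟨t, ht⟩ := hx
    obtain ⟨t', ht'⟩ := hy
    refine ⟨t ∪ t', fun E _ _ w h => ?_⟩
    obtain ⟨a, ha⟩ := ht E w fun b hb => h b (by simp [hb])
    obtain ⟨a', ha'⟩ := ht' E w fun b hb => h b (by simp [hb])
    exact ⟨a + a', by simp [ha, ha']⟩

theorem exists_finset_of_map_eq_zero {A₀ : Type*} {E B B₀ : Type*} [CommRing A₀] [CommRing B]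
    [CommRing B₀] [Algebra A₀ B] [Algebra A₀ B₀] [Module.Flat A₀ B₀] [CommRing E] [Algebra A₀ E]
    (w : E →ₐ[A₀] B) (x : E ⊗[A₀] B₀)
    (hx : Algebra.TensorProduct.map w (AlgHom.id A₀ B₀) x = 0) :
    ∃ F : Finset E, (∀ e ∈ F, w e = 0) ∧
      x ∈ Ideal.span ((Algebra.TensorProduct.includeLeft : E →ₐ[A₀] E ⊗[A₀] B₀) '' F) := by
  classical
  have hk := Algebra.TensorProduct.rTensor_ker (R := A₀) (S := A₀) (C := B₀) w.rangeRestrict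
    w.rangeRestrict_surjective
  have hinj : Function.Injective (Algebra.TensorProduct.map w.range.val (AlgHom.id A₀ B₀)) :=
    Module.Flat.rTensor_preserves_injective_linearMap (M := B₀) w.range.val.toLinearMap
      Subtype.val_injective
  have hxk : x ∈ RingHom.ker (Algebra.TensorProduct.map w.rangeRestrict (AlgHom.id A₀ B₀)) := by
    rw [RingHom.mem_ker]
    apply hinj
    rw [map_zero, ← hx, ← AlgHom.comp_apply, ← Algebra.TensorProduct.map_comp]
    rfl
  rw [hk] at hxk
  obtain ⟨T, hT, hxT⟩ := Submodule.mem_span_finite_of_mem_span hxk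
  obtain ⟨F, hF, rfl⟩ := Finset.subset_set_image_iff.mp hT
  refine ⟨F, fun e he => ?_, by simpa using hxT⟩
  have := hF he
  simpa [AlgHom.ker_rangeRestrict] using this

theorem IndSm.comp {A B D : Type v} [CommRing A] [CommRing B] [CommRing D] {f : A →+* B}
    {g : B →+* D} (hg : g.IndSm) (hf : f.IndSm) : (g.comp f).IndSm := by
  classical
  intro n x R hx
  obtain ⟨S₁, _, _, h₁, s, hS₁, hB, hs, hr⟩ := hg n x (R.image (map f)) (by
    simp only [Finset.forall_mem_image]
    intro r hr
    rw [eval₂_map]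
    exact hx r hr)
  obtain ⟨A₀, B₀, _, _, hA₀, hB₀, ⟨e⟩⟩ := Algebra.Smooth.exists_subalgebra_fg ℤ B S₁
  choose t ht using fun i => exists_finset_mem_range_map.{v} (e (s i))
  obtain ⟨E, _, _, j, w, hE, hwf, hwj, hwt⟩ :=
    exists_finitePresentation_of_fg f A₀ hA₀ (Finset.univ.biUnion t)
  let : Algebra A₀ E := j.toAlgebra
  let wA : E →ₐ[A₀] B := { w with commutes' := fun a => congr($hwj a) }
  choose s' hs' using fun i => ht i E wA (fun b hb => hwt b (by simp; exact ⟨i, hb⟩))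
  have hrE : ∀ r ∈ R, Algebra.TensorProduct.map wA (AlgHom.id A₀ B₀)
      (eval₂ ((Algebra.TensorProduct.includeLeft : E →ₐ[A₀] E ⊗[A₀] B₀).toRingHom.comp
        (algebraMap A E)) s' r) = 0 := by
    intro r hr'
    have h0 := hr (map f r) (Finset.mem_image_of_mem _ hr')
    have h1 : e (eval₂ (algebraMap B S₁) s (map f r)) = 0 := by rw [h0, map_zero]
    rw [← h1, ← RingHom.coe_coe, hom_eval₂, eval₂_map, ← RingHom.coe_coe e, hom_eval₂]
    congr 1
    · ext a
      simp
      change w (algebraMap A E a) ⊗ₜ[A₀] (1 : B₀) = _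
      rw [← hwf]
      rfl
    · ext i
      exact hs' i
  choose! F hF hxF using fun r hr => exists_finset_of_map_eq_zero wA _ (hrE r hr)
  let I : Ideal E := Ideal.span (R.biUnion F : Finset E)
  have hI : ∀ a ∈ I, w a = 0 := by
    have : I ≤ RingHom.ker w := by
      rw [Ideal.span_le]
      intro a ha
      simp at ha
      obtain ⟨r, hr, ha⟩ := ha
      exact hF r hr a ha
    exact fun a ha => this ha
  have : Algebra.FinitePresentation A (E ⧸ I) :=
    Algebra.FinitePresentation.quotient (Submodule.fg_span (Finset.finite_toSet _))
  obtain ⟨S, _, _, h, φ, hS, hSA, hφ⟩ := hf.factor (Ideal.Quotient.lift I w hI) (by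
    ext a; exact congr($hwf a))
  let φ' : E →+* S := φ.toRingHom.comp (Ideal.Quotient.mk I)
  have hφ' : h.comp φ' = w := by
    rw [← RingHom.comp_assoc, hφ]
    ext a; rfl
  let : Algebra A₀ S := (φ'.comp j).toAlgebra
  let φA : E →ₐ[A₀] S := { φ' with commutes' := fun a => rfl }
  let : Algebra A₀ D := ((g.comp A₀.val.toRingHom)).toAlgebra
  let hD₁ : S →ₐ[A₀] D :=
    { g.comp h with
      commutes' := fun a => by
        change g ((h.comp φ') (j a)) = g (A₀.val.toRingHom a)
        rw [hφ', ← hwj]; rfl }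
  let hD₀ : B ⊗[A₀] B₀ →+* D := h₁.comp e.symm.toRingEquiv.toRingHom
  have hD₀' : ∀ b : B, hD₀ (b ⊗ₜ 1) = g b := by
    intro b
    have : e.symm (b ⊗ₜ 1) = algebraMap B S₁ b := by
      have := e.symm.commutes b
      simpa using this
    change h₁ (e.symm (b ⊗ₜ 1)) = _
    rw [this, ← hB]; rfl
  let hD₂ : B₀ →ₐ[A₀] D :=
    { hD₀.comp (Algebra.TensorProduct.includeRight : B₀ →ₐ[A₀] B ⊗[A₀] B₀).toRingHom with
      commutes' := fun a => by
        change hD₀ (1 ⊗ₜ algebraMap A₀ B₀ a) = g a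
        rw [← hD₀', ← Algebra.TensorProduct.tmul_one_eq_one_tmul]; rfl }
  let h₂ : S ⊗[A₀] B₀ →ₐ[A₀] D := Algebra.TensorProduct.lift hD₁ hD₂ fun _ _ => Commute.all _ _
  have hcomm : h₂.toRingHom.comp (Algebra.TensorProduct.map φA (AlgHom.id A₀ B₀)).toRingHom
      = hD₀.comp (Algebra.TensorProduct.map wA (AlgHom.id A₀ B₀)).toRingHom := by
    have key : ∀ z, h₂ (Algebra.TensorProduct.map φA (AlgHom.id A₀ B₀) z)
        = hD₀ (Algebra.TensorProduct.map wA (AlgHom.id A₀ B₀) z) := by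
      intro z
      induction z using TensorProduct.induction_on with
      | zero => simp
      | add a b ha hb => simp only [map_add, ha, hb]
      | tmul a b =>
        simp only [Algebra.TensorProduct.map_tmul, AlgHom.coe_id, id_eq, h₂,
          Algebra.TensorProduct.lift_tmul]
        have e1 : wA a ⊗ₜ[A₀] b = (wA a ⊗ₜ[A₀] (1 : B₀)) * ((1 : B) ⊗ₜ[A₀] b) := by simp
        rw [e1, map_mul, hD₀']
        congr 1
        change g ((h.comp φ') a) = g (w a)
        rw [hφ']
    exact RingHom.ext key
  have : Algebra.Smooth A (S ⊗[A₀] B₀) := Algebra.Smooth.comp A S _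
  refine ⟨S ⊗[A₀] B₀, inferInstance, inferInstance, h₂.toRingHom,
    fun i => Algebra.TensorProduct.map φA (AlgHom.id A₀ B₀) (s' i), inferInstance, ?_, ?_, ?_⟩
  · ext a
    change h₂ (algebraMap A S a ⊗ₜ[A₀] 1) = _
    simp only [h₂, Algebra.TensorProduct.lift_tmul, map_one, mul_one]
    change g ((h.comp (algebraMap A S)) a) = _
    rw [hSA]; rfl
  · intro i
    have := congr($hcomm (s' i))
    change _ = hD₀ (Algebra.TensorProduct.map wA (AlgHom.id A₀ B₀) (s' i)) at this
    rw [hs'] at this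
    refine Eq.trans this ?_
    simp [hD₀, hs]
  · intro r hr'
    have hz : Algebra.TensorProduct.map φA (AlgHom.id A₀ B₀)
      (eval₂ ((Algebra.TensorProduct.includeLeft : E →ₐ[A₀] E ⊗[A₀] B₀).toRingHom.comp
        (algebraMap A E)) s' r) = 0 := by
      have hle : Ideal.span ((Algebra.TensorProduct.includeLeft : E →ₐ[A₀] E ⊗[A₀] B₀) ''
          (F r : Set E)) ≤ RingHom.ker (Algebra.TensorProduct.map φA (AlgHom.id A₀ B₀)) := by
        rw [Ideal.span_le]
        rintro _ ⟨a, ha, rfl⟩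
        have : φ' a = 0 := by
          change φ (Ideal.Quotient.mk I a) = 0
          rw [Ideal.Quotient.eq_zero_iff_mem.mpr, map_zero]
          exact Ideal.subset_span (by simp; exact ⟨r, hr', ha⟩)
        change Algebra.TensorProduct.map φA (AlgHom.id A₀ B₀) (a ⊗ₜ 1) = 0
        rw [Algebra.TensorProduct.map_tmul]
        change φ' a ⊗ₜ[A₀] _ = 0
        rw [this, zero_tmul]
      exact hle (hxF r hr')
    rw [← hz, ← RingHom.coe_coe (Algebra.TensorProduct.map φA (AlgHom.id A₀ B₀)), hom_eval₂]
    congr 1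
    ext a
    simp
    change _ = φ (Ideal.Quotient.mk I (algebraMap A E a)) ⊗ₜ[A₀] (1 : B₀)
    have : φ (Ideal.Quotient.mk I (algebraMap A E a)) = algebraMap A S a := φ.commutes a
    rw [this]

theorem IndSm.of_injective {A B : Type v} [CommRing A] [CommRing B] {f : A →+* B}
    (H : ∀ X : Finset B, ∃ (S : Type v) (_ : CommRing S) (_ : Algebra A S) (h : S →+* B),
      Algebra.Smooth A S ∧ h.comp (algebraMap A S) = f ∧ Function.Injective h ∧
      ∀ b ∈ X, b ∈ h.range) : f.IndSm := by
  classical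
  intro n x R hx
  obtain ⟨S, _, _, h, hS, hf, hinj, hX⟩ := H (Finset.univ.image x)
  choose y hy using fun i => hX (x i) (by simp)
  refine ⟨S, _, _, h, y, hS, hf, hy, fun r hr => hinj ?_⟩
  rw [hom_eval₂, hf, map_zero, ← hx r hr]
  congr 1
  ext i
  exact hy i

/-- `f : A →+* B` is existentially closed if every finite polynomial system over `A` that is
solvable in `B` is solvable in `A`. -/
def ExClosed {A B : Type v} [CommRing A] [CommRing B] (f : A →+* B) : Prop :=
  ∀ (n : ℕ) (R : Finset (MvPolynomial (Fin n) A)) (x : Fin n → B),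
    (∀ r ∈ R, eval₂ f x r = 0) → ∃ y : Fin n → A, ∀ r ∈ R, eval y r = 0

theorem ExClosed.injective {A B : Type v} [CommRing A] [CommRing B] {f : A →+* B}
    (hf : f.ExClosed) : Function.Injective f := by
  rw [injective_iff_map_eq_zero]
  intro a ha
  obtain ⟨y, hy⟩ := hf 0 {C a} 0 (by simp [ha])
  simpa using hy

theorem ExClosed.comp {A B D : Type v} [CommRing A] [CommRing B] [CommRing D] {f : A →+* B}
    {g : B →+* D} (hg : g.ExClosed) (hf : f.ExClosed) : (g.comp f).ExClosed := by
  classical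
  intro n R x hx
  obtain ⟨y, hy⟩ := hg n (R.image (map f)) x (by
    simp only [Finset.forall_mem_image]
    intro r hr
    rw [eval₂_map]
    exact hx r hr)
  refine hf n R y fun r hr => ?_
  have := hy _ (Finset.mem_image_of_mem _ hr)
  rwa [eval_map] at this

theorem ExClosed.id (A : Type v) [CommRing A] : (RingHom.id A).ExClosed :=
  fun _ _ x hx => ⟨x, hx⟩

theorem IndSm.of_exists_exClosed {A B : Type v} [CommRing A] [CommRing B] {f : A →+* B}
    (H : ∀ (n : ℕ) (x : Fin n → B) (R : Finset (MvPolynomial (Fin n) A)),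
      (∀ r ∈ R, eval₂ f x r = 0) →
      ∃ (D : Type v) (_ : CommRing D) (g : B →+* D) (S : Type v) (_ : CommRing S)
        (_ : Algebra A S) (h : S →+* D) (y : Fin n → S),
        g.ExClosed ∧ Algebra.Smooth A S ∧ h.comp (algebraMap A S) = g.comp f ∧
        (∀ i, h (y i) = g (x i)) ∧ ∀ r ∈ R, eval₂ (algebraMap A S) y r = 0) : f.IndSm := by
  classical
  intro n x R hx
  obtain ⟨D, _, g, S, _, _, k, y, hg, hS, hk, hy, hr⟩ := H n x R hx
  obtain ⟨m, π, hπ, K, hK⟩ := Algebra.FinitePresentation.out (R := A) (A := S)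
  choose q hq using fun i => hπ (y i)
  have hev : ∀ p : MvPolynomial (Fin m) A, eval₂ (g.comp f) (fun i => k (π (X i))) p = k (π p) := by
    intro p
    have : (eval₂Hom (g.comp f) (fun i => k (π (X i)))) = k.comp π.toRingHom := by
      ext a
      · simp [← hk]
      · simp
    exact congr($this p)
  obtain ⟨z, hz⟩ := hg m (K.image (map f) ∪
    Finset.univ.image fun i => MvPolynomial.map f (q i) - C (x i))
    (fun i => k (π (X i))) (by
      intro r hr
      simp only [Finset.mem_union, Finset.mem_image, Finset.mem_univ, true_and] at hr
      obtain ⟨p, hp, rfl⟩ | ⟨i, rfl⟩ := hr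
      · have : p ∈ RingHom.ker π.toRingHom := hK ▸ Ideal.subset_span hp
        have h0 : π p = 0 := this
        rw [eval₂_map, hev, h0, map_zero]
      · rw [eval₂_sub, eval₂_map, hev, hq, hy]
        simp)
  let := f.toAlgebra
  have hker : ∀ p : MvPolynomial (Fin m) A, π p = 0 → aeval (R := A) z p = 0 := by
    intro p hp
    have hle : RingHom.ker π.toRingHom ≤ RingHom.ker (aeval (R := A) z).toRingHom := by
      rw [← hK, Ideal.span_le]
      intro r hr'
      have := hz (map f r) (by simp; exact Or.inl ⟨r, hr', rfl⟩)
      rw [eval_map] at this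
      exact this
    exact hle (show p ∈ RingHom.ker π.toRingHom from hp)
  let l := AlgHom.liftOfSurjective π hπ (aeval z) (fun p hp => hker p hp)
  have hl : ∀ p, l (π p) = aeval z p := fun p => AlgHom.liftOfSurjective_apply ..
  refine ⟨S, _, _, l.toRingHom, y, hS, ?_, fun i => ?_, hr⟩
  · ext a
    exact l.commutes a
  · rw [← hq]
    refine (hl _).trans ?_
    have := hz (MvPolynomial.map f (q i) - C (x i)) (by simp)
    rw [map_sub, eval_map, sub_eq_zero, eval_C] at this
    exact this

theorem IndSm.of_comp_exClosed {A B D : Type v} [CommRing A] [CommRing B] [CommRing D]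
    {f : A →+* B} {g : B →+* D} (h : (g.comp f).IndSm) (hg : g.ExClosed) : f.IndSm := by
  refine .of_exists_exClosed fun n x R hx => ?_
  obtain ⟨S, _, _, k, y, hS, hk, hy, hr⟩ := h n (g ∘ x) R (by
    intro r hr
    have := congr(g $(hx r hr))
    rwa [hom_eval₂, map_zero] at this)
  exact ⟨D, inferInstance, g, S, inferInstance, inferInstance, k, y, hg, hS, hk, hy, hr⟩

theorem IndSm.of_smooth (A B : Type v) [CommRing A] [CommRing B] [Algebra A B]
    [Algebra.Smooth A B] : (algebraMap A B).IndSm := fun _ x _ hR =>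
  ⟨B, inferInstance, inferInstance, .id B, x, inferInstance, rfl, fun _ => rfl, hR⟩

end RingHom

theorem ValuationRing.exists_forall_dvd {W : Type*} [CommRing W] [IsDomain W] [ValuationRing W]
    {ι : Type*} (s : Finset ι) (hs : s.Nonempty) (f : ι → W) : ∃ i ∈ s, ∀ j ∈ s, f i ∣ f j := by
  classical
  induction hs using Finset.Nonempty.cons_induction with
  | singleton a => exact ⟨a, by simp, by simp⟩
  | cons a s ha hs ih =>
    obtain ⟨i, hi, h⟩ := ih
    rcases ValuationRing.dvd_total (f a) (f i) with h' | h'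
    · exact ⟨a, by simp, by simpa using fun j hj => h'.trans (h j hj)⟩
    · exact ⟨i, by simp [hi], by simpa using ⟨h', h⟩⟩

theorem MvPolynomial.exists_eq_C_mul_isUnit_coeff {W : Type*} [CommRing W] [IsDomain W]
    [ValuationRing W] {σ : Type*} (p : MvPolynomial σ W) (hp : p ≠ 0) :
    ∃ (m : σ →₀ ℕ) (p₀ : MvPolynomial σ W), p.coeff m ≠ 0 ∧ p = C (p.coeff m) * p₀ ∧
    IsUnit (p₀.coeff m) := by
  classical
  obtain ⟨m, hm, h⟩ := ValuationRing.exists_forall_dvd p.support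
    (Finset.nonempty_iff_ne_empty.mpr (by simpa using hp)) p.coeff
  have hm0 : p.coeff m ≠ 0 := by simpa using hm
  have hdvd : C (p.coeff m) ∣ p := by
    rw [C_dvd_iff_dvd_coeff]
    intro j
    by_cases hj : j ∈ p.support
    · exact h j hj
    · simp only [mem_support_iff, not_not] at hj
      simp [hj]
  obtain ⟨p₀, hp₀⟩ := hdvd
  refine ⟨m, p₀, hm0, hp₀, ?_⟩
  have : p.coeff m * 1 = p.coeff m * p₀.coeff m := by
    conv_lhs => rw [hp₀, coeff_C_mul, mul_one]
  rw [← mul_left_cancel₀ hm0 this]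
  exact isUnit_one

open IsLocalRing in
theorem RingHom.exists_gauss_extension {W : Type v} [CommRing W] [IsDomain W] [ValuationRing W]
    (hQ : ∀ n : ℕ, n ≠ 0 → IsUnit (n : W)) (σ : Type v) :
    ∃ (Ω : Type v) (_ : CommRing Ω) (_ : IsDomain Ω) (_ : ValuationRing Ω) (ι : W →+* Ω)
      (T : σ → Ω), ι.ExClosed ∧ (∀ w : Ω, ∃ a : W, Associated (ι a) w) ∧
      ∀ p : MvPolynomial σ W, (∃ m, IsUnit (p.coeff m)) →
        IsUnit (p.eval₂ ι T) := by
  classical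
  let k := ResidueField W
  let P : Ideal (MvPolynomial σ W) := RingHom.ker (MvPolynomial.map (residue W))
  have hPp : P.IsPrime := RingHom.ker_isPrime _
  let Ω := Localization.AtPrime P
  let ι : W →+* Ω := (algebraMap (MvPolynomial σ W) Ω).comp MvPolynomial.C
  have hev : ∀ p : MvPolynomial σ W,
      p.eval₂ ι (fun i => algebraMap (MvPolynomial σ W) Ω (MvPolynomial.X i)) =
      algebraMap _ Ω p := by
    intro p
    have : MvPolynomial.eval₂Hom ι (fun i => algebraMap (MvPolynomial σ W) Ω (MvPolynomial.X i))
        = algebraMap (MvPolynomial σ W) Ω := by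
      ext <;> simp [ι]
    exact congr($this p)
  have hunit : ∀ p : MvPolynomial σ W, (∃ m, IsUnit (p.coeff m)) →
      IsUnit (algebraMap _ Ω p) := by
    rintro p ⟨m, hm⟩
    refine IsLocalization.map_units Ω (⟨p, ?_⟩ : P.primeCompl)
    intro hp
    have h0 : MvPolynomial.coeff m (MvPolynomial.map (residue W) p) = 0 := by
      rw [show MvPolynomial.map (residue W) p = 0 from hp]; simp
    rw [MvPolynomial.coeff_map, residue_eq_zero_iff] at h0
    exact h0 hm
  have hassoc : ∀ w : Ω, ∃ a : W, Associated (ι a) w := by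
    intro w
    obtain ⟨p, s, rfl⟩ := IsLocalization.exists_mk'_eq P.primeCompl w
    have h1 : Associated (algebraMap _ Ω p) (IsLocalization.mk' Ω p s) := by
      have hu := (IsLocalization.map_units Ω s)
      refine Associated.symm ⟨hu.unit, ?_⟩
      simp
    by_cases hp : p = 0
    · exact ⟨0, by simp [hp]⟩
    · obtain ⟨m, p₀, h0, hpp, hu⟩ := p.exists_eq_C_mul_isUnit_coeff hp
      refine ⟨p.coeff m, Associated.trans ⟨(hunit p₀ ⟨m, hu⟩).unit, ?_⟩ h1⟩
      conv_rhs => rw [hpp]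
      simp [ι]
  have : CharZero k := by
    refine charZero_of_inj_zero fun n hn => ?_
    by_contra h
    have h1 : residue W (n : W) = 0 := by simpa using hn
    rw [residue_eq_zero_iff] at h1
    exact h1 (hQ n h)
  have hΩd : IsDomain Ω := IsLocalization.isDomain_localization P.primeCompl_le_nonZeroDivisors
  refine ⟨Ω, inferInstance, hΩd,
    ?_, ι, fun i => algebraMap (MvPolynomial σ W) Ω (MvPolynomial.X i), ?_, hassoc, ?_⟩
  · refine ValuationRing.iff_dvd_total.mpr ⟨fun a b => ?_⟩
    obtain ⟨a', ha⟩ := hassoc a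
    obtain ⟨b', hb⟩ := hassoc b
    rw [← ha.dvd_iff_dvd_left, ← ha.dvd_iff_dvd_right, ← hb.dvd_iff_dvd_left,
      ← hb.dvd_iff_dvd_right]
    exact (ValuationRing.dvd_total a' b').imp (map_dvd ι) (map_dvd ι)
  · intro n R x hx
    choose p s hps using fun i => IsLocalization.exists_mk'_eq P.primeCompl (x i)
    let d : MvPolynomial σ W := ∏ i, (s i : MvPolynomial σ W)
    have hd : d ∉ P := by
      have : d ∈ P.primeCompl := Submonoid.prod_mem _ fun i _ => (s i).2
      exact this
    obtain ⟨t', ht'⟩ : ∃ t : σ → k, MvPolynomial.eval t (MvPolynomial.map (residue W) d) ≠ 0 := by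
      by_contra! h
      exact hd (MvPolynomial.funext (q := 0) (by simpa using h))
    choose t ht using fun i => residue_surjective (t' i)
    have hdt : IsUnit (MvPolynomial.eval t d) := by
      rw [← residue_ne_zero_iff_isUnit]
      convert ht'
      rw [MvPolynomial.eval_map, ← funext ht, MvPolynomial.eval, MvPolynomial.coe_eval₂Hom,
        MvPolynomial.hom_eval₂]
      rfl
    have hdΩ : IsUnit (algebraMap _ Ω d) := IsLocalization.map_units Ω (⟨d, hd⟩ : P.primeCompl)
    let L := Localization.Away d
    let j : L →+* Ω := IsLocalization.Away.lift d hdΩ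
    let ev : L →+* W := IsLocalization.Away.lift d hdt
    have hd0 : d ≠ 0 := fun h => hd (h ▸ P.zero_mem)
    have hj : Function.Injective j := by
      refine (IsLocalization.lift_injective_iff _).mpr fun x y => ?_
      rw [(IsLocalization.injective L (powers_le_nonZeroDivisors_of_noZeroDivisors hd0)).eq_iff,
        (IsLocalization.injective Ω P.primeCompl_le_nonZeroDivisors).eq_iff]
    have hsL : ∀ i, IsUnit (algebraMap (MvPolynomial σ W) L (s i : MvPolynomial σ W)) := fun i =>
      isUnit_of_dvd_unit (map_dvd (algebraMap (MvPolynomial σ W) L)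
        (Finset.dvd_prod_of_mem (fun i => (s i : MvPolynomial σ W))
        (Finset.mem_univ i)))
        (IsLocalization.Away.algebraMap_isUnit d)
    let x' : Fin n → L := fun i => algebraMap (MvPolynomial σ W) L (p i) * (hsL i).unit⁻¹
    have hx' : ∀ i, j (x' i) = x i := by
      intro i
      rw [← hps, eq_comm, IsLocalization.mk'_eq_iff_eq_mul]
      have h1 : algebraMap _ Ω (s i : MvPolynomial σ W) =
        j (algebraMap (MvPolynomial σ W) L (s i)) := by simp [j]
      have h2 : algebraMap _ Ω (p i : MvPolynomial σ W) =
        j (algebraMap (MvPolynomial σ W) L (p i)) := by simp [j]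
      rw [h1, h2, ← map_mul]
      simp only [x']
      rw [mul_assoc, IsUnit.val_inv_mul, mul_one]
    have hjC : ι = j.comp ((algebraMap (MvPolynomial σ W) L).comp MvPolynomial.C) := by
      ext a; simp [ι, j]
    have heC : (RingHom.id W) =
      ev.comp ((algebraMap (MvPolynomial σ W) L).comp MvPolynomial.C) := by
      ext a; simp [ev]
    refine ⟨fun i => ev (x' i), fun r hr => ?_⟩
    have h0 : r.eval₂ ((algebraMap (MvPolynomial σ W) L).comp MvPolynomial.C) x' = 0 := by
      apply hj
      rw [MvPolynomial.hom_eval₂, ← hjC, map_zero, ← hx r hr]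
      congr 1
      ext i; exact hx' i
    have := congr(ev $h0)
    rw [MvPolynomial.hom_eval₂, ← heC, map_zero] at this
    exact this
  · intro p hp
    rw [hev]
    exact hunit p hp

namespace RingHom

/-- The subring of fractions of elements of the range of `g` that lie in the target domain. -/
def divClosure {R W : Type*} [CommRing R] [CommRing W] [IsDomain W] (g : R →+* W) :
    Subring W where
  carrier := {w | ∃ p r, g r ≠ 0 ∧ w * g r = g p}
  mul_mem' := by
    rintro a b ⟨p, r, hr, h⟩ ⟨p', r', hr', h'⟩
    refine ⟨p * p', r * r', by simp [hr, hr'], ?_⟩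
    rw [map_mul, map_mul, ← h, ← h']
    ring
  one_mem' := ⟨1, 1, by simp, by simp⟩
  add_mem' := by
    rintro a b ⟨p, r, hr, h⟩ ⟨p', r', hr', h'⟩
    refine ⟨p * r' + p' * r, r * r', by simp [hr, hr'], ?_⟩
    rw [map_add, map_mul, map_mul, map_mul, ← h, ← h']
    ring
  zero_mem' := ⟨0, 1, by simp, by simp⟩
  neg_mem' := by
    rintro a ⟨p, r, hr, h⟩
    exact ⟨-p, r, hr, by rw [neg_mul, h, map_neg]⟩

section divClosure

variable {R W : Type*} [CommRing R] [CommRing W] [IsDomain W] (g : R →+* W)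

theorem mem_divClosure {w : W} : w ∈ g.divClosure ↔ ∃ p r, g r ≠ 0 ∧ w * g r = g p := Iff.rfl

theorem apply_mem_divClosure (r : R) : g r ∈ g.divClosure := ⟨r, 1, by simp, by simp⟩

theorem mem_divClosure_of_mul_mem {a c : W} (ha : a ∈ g.divClosure) (h0 : a ≠ 0)
    (h : c * a ∈ g.divClosure) : c ∈ g.divClosure := by
  obtain ⟨p, r, hr, h1⟩ := ha
  obtain ⟨p', r', hr', h2⟩ := h
  refine ⟨p' * r, p * r', ?_, ?_⟩
  · rw [map_mul, ← h1]
    simp [hr, hr', h0]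
  · rw [map_mul, map_mul, ← h1, ← h2]
    ring

/-- `g` with target restricted to `g.divClosure`. -/
def toDivClosure : R →+* g.divClosure := g.codRestrict _ g.apply_mem_divClosure

@[simp] theorem coe_toDivClosure (r : R) : (g.toDivClosure r : W) = g r := rfl

end divClosure

/-- The embeddings `f : A →+* W` that are compatible with division and have trivial value group
extension. -/
structure Immediate {A W : Type*} [CommRing A] [CommRing W] (f : A →+* W) : Prop where
  inj : Function.Injective f
  exists_of_mul_eq : ∀ a b c, a ≠ 0 → f a * c = f b → ∃ c', f c' = c
  exists_associated : ∀ w, ∃ a, Associated (f a) w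

namespace Immediate

variable {A W : Type*} [CommRing A] [CommRing W] {f : A →+* W}

theorem isUnit (hf : f.Immediate) {a : A} (h : IsUnit (f a)) : IsUnit a := by
  obtain ⟨c, hc⟩ := h.exists_right_inv
  by_cases ha : a = 0
  · have h10 : (1 : A) = 0 := hf.inj (by rw [map_one, map_zero, ← hc, ha, map_zero, zero_mul])
    exact IsUnit.of_mul_eq_one 1 (by rw [ha, zero_mul]; exact h10.symm)
  · obtain ⟨c', rfl⟩ := hf.exists_of_mul_eq a 1 c ha (by rw [hc, map_one])
    refine IsUnit.of_mul_eq_one c' (hf.inj ?_)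
    rw [map_mul, hc, map_one]

theorem natCast_isUnit (hf : f.Immediate) (hQ : ∀ n : ℕ, n ≠ 0 → IsUnit (n : W)) (n : ℕ)
    (hn : n ≠ 0) : IsUnit (n : A) :=
  hf.isUnit (by simpa using hQ n hn)

theorem isDomain [IsDomain W] (hf : f.Immediate) : IsDomain A := hf.inj.isDomain f

theorem dvd_of_dvd (hf : f.Immediate) {a b : A} (h : f a ∣ f b) : a ∣ b := by
  by_cases ha : a = 0
  · subst ha
    rw [map_zero, zero_dvd_iff] at h
    rw [hf.inj (h.trans (map_zero f).symm)]
  · obtain ⟨c, hc⟩ := h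
    obtain ⟨c', rfl⟩ := hf.exists_of_mul_eq a b c ha hc.symm
    exact ⟨c', hf.inj (by rw [hc, map_mul])⟩

theorem valuationRing [IsDomain W] [ValuationRing W] (hf : f.Immediate) :
    haveI := hf.isDomain
    ValuationRing A := by
  have := hf.isDomain
  exact ValuationRing.iff_dvd_total.mpr ⟨fun a b =>
    (ValuationRing.dvd_total (f a) (f b)).imp hf.dvd_of_dvd hf.dvd_of_dvd⟩

theorem divClosure [IsDomain W] {R : Type*} [CommRing R] (hf : f.Immediate) (g : R →+* W)
    (j : A →+* R) (hj : g.comp j = f) : g.divClosure.subtype.Immediate where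
  inj := Subtype.val_injective
  exists_of_mul_eq a b c ha h :=
    ⟨⟨c, g.mem_divClosure_of_mul_mem a.2 (by simpa using ha) (by
      rw [mul_comm]
      change (a : W) * c = b at h
      rw [h]; exact b.2)⟩, rfl⟩
  exists_associated w := by
    obtain ⟨a, ha⟩ := hf.exists_associated w
    exact ⟨g.toDivClosure (j a), by rw [← hj] at ha; exact ha⟩

end Immediate

open Polynomial

theorem _root_.Polynomial.exists_eq_C_mul_isUnit_coeff {W : Type*} [CommRing W] [IsDomain W]
    [ValuationRing W] (p : W[X]) (hp : p ≠ 0) :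
    ∃ (e : W) (p₀ : W[X]), e ≠ 0 ∧ p = C e * p₀ ∧ ∃ m, IsUnit (p₀.coeff m) := by
  classical
  obtain ⟨m, hm, h⟩ := ValuationRing.exists_forall_dvd p.support
    (Finset.nonempty_iff_ne_empty.mpr (by simpa using hp)) p.coeff
  have hm0 : p.coeff m ≠ 0 := by simpa using hm
  have hdvd : C (p.coeff m) ∣ p := by
    rw [C_dvd_iff_dvd_coeff]
    intro j
    by_cases hj : j ∈ p.support
    · exact h j hj
    · simp only [mem_support_iff, not_not] at hj
      simp [hj]
  obtain ⟨p₀, hp₀⟩ := hdvd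
  refine ⟨p.coeff m, p₀, hm0, hp₀, m, ?_⟩
  have : p.coeff m * 1 = p.coeff m * p₀.coeff m := by
    conv_lhs => rw [hp₀, coeff_C_mul, mul_one]
  rw [← mul_left_cancel₀ hm0 this]
  exact isUnit_one

theorem indSm_of_fractions {A W : Type v} [CommRing A] [CommRing W] [IsDomain W]
    (f : A →+* W) (D : Subring W) (hD : ∀ r ∈ D, IsUnit r → ∀ w, w * r ∈ D → w ∈ D)
    (f' : A →+* D) (hf' : D.subtype.comp f' = f)
    (H : ∀ X : Finset D, ∃ (P : Type v) (_ : CommRing P) (_ : Algebra A P) (g : P →+* W),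
      Algebra.Smooth A P ∧ Function.Injective g ∧ g.comp (algebraMap A P) = f ∧
      (∀ p, g p ∈ D) ∧ ∀ b ∈ X, ∃ p r, IsUnit (g r) ∧ b * g r = g p) : f'.IndSm := by
  classical
  refine IndSm.of_injective fun X => ?_
  obtain ⟨P, _, _, g, hP, hg, hgf, hgD, hX⟩ := H X
  choose! p r hr hb using hX
  have : IsDomain P := hg.isDomain g
  let d := ∏ b ∈ X, r b
  have hd : IsUnit (g d) := by
    rw [map_prod, IsUnit.prod_iff]
    exact hr
  have hd0 : d ≠ 0 := by rintro h; rw [h, map_zero] at hd; exact not_isUnit_zero hd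
  let S := Localization.Away d
  let h : S →+* W := IsLocalization.Away.lift d hd
  have hh : ∀ q, h (algebraMap P S q) = g q := fun q => by simp [h]
  have hinj : Function.Injective h := by
    refine (IsLocalization.lift_injective_iff _).mpr fun x y => ?_
    rw [(IsLocalization.injective S (powers_le_nonZeroDivisors_of_noZeroDivisors hd0)).eq_iff,
      hg.eq_iff]
  have hmem : ∀ s, h s ∈ D := by
    intro s
    obtain ⟨q, t, rfl⟩ := IsLocalization.exists_mk'_eq (Submonoid.powers d) s
    refine hD (g t) (hgD _) ?_ _ ?_
    · obtain ⟨k, hk⟩ := t.2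
      change d ^ k = t at hk
      rw [← hk, map_pow]
      exact hd.pow k
    · rw [← hh, ← map_mul, IsLocalization.mk'_spec, hh]
      exact hgD _
  have : Algebra.Smooth P S :=
    { formallySmooth := Algebra.FormallySmooth.of_isLocalization (Submonoid.powers d)
      finitePresentation := IsLocalization.Away.finitePresentation d }
  refine ⟨S, inferInstance, inferInstance, h.codRestrict D hmem, Algebra.Smooth.comp A P S, ?_,
    fun a b hab => hinj congr(($hab : W)), fun b hbX => ?_⟩
  · ext a
    change h (algebraMap A S a) = _
    rw [IsScalarTower.algebraMap_apply A P S, hh, ← RingHom.comp_apply, hgf, ← hf']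
    rfl
  · have hu : IsUnit (algebraMap P S (r b)) :=
      isUnit_of_dvd_unit (map_dvd (algebraMap P S) (Finset.dvd_prod_of_mem r hbX))
        (IsLocalization.Away.algebraMap_isUnit d)
    refine ⟨algebraMap P S (p b) * hu.unit⁻¹, Subtype.ext ?_⟩
    change h _ = b
    refine (hr b hbX).mul_left_injective ?_
    change h _ * g (r b) = b * g (r b)
    rw [hb b hbX, ← hh, ← map_mul, mul_assoc, IsUnit.val_inv_mul, mul_one, hh]

theorem Immediate.indSm_of_isUnit {A W : Type v} [CommRing A] [CommRing W] [IsDomain W]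
    [ValuationRing W] {f : A →+* W} (hf : f.Immediate) (ζ : W)
    (hζ : ∀ p : A[X], (∃ m, IsUnit (p.coeff m)) → IsUnit (p.eval₂ f ζ)) :
    ((eval₂RingHom f ζ).toDivClosure.comp C).IndSm := by
  have := hf.isDomain
  have := hf.valuationRing
  have hg : Function.Injective (eval₂RingHom f ζ) := by
    rw [injective_iff_map_eq_zero]
    intro p h
    by_contra hp
    obtain ⟨e, p₀, he, rfl, hu⟩ := p.exists_eq_C_mul_isUnit_coeff hp
    rw [map_mul, coe_eval₂RingHom, eval₂_C] at h
    rcases mul_eq_zero.mp h with h | h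
    · exact he (hf.inj (h.trans (map_zero f).symm))
    · exact (hζ p₀ hu).ne_zero h
  refine indSm_of_fractions f _ (fun r hr hu w hw => mem_divClosure_of_mul_mem _ hr hu.ne_zero hw)
    _ (by ext a; simp) fun X => ⟨A[X], inferInstance, inferInstance, eval₂RingHom f ζ,
      { finitePresentation := .polynomial A A }, hg, by ext a; simp,
        fun p => apply_mem_divClosure _ p, ?_⟩
  rintro ⟨b, p, r, hr, hb⟩ -
  have hr0 : r ≠ 0 := by rintro rfl; simp at hr
  obtain ⟨e, r₀, he, rfl, hu⟩ := r.exists_eq_C_mul_isUnit_coeff hr0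
  by_cases hp : p = 0
  · refine ⟨0, r₀, hζ r₀ hu, ?_⟩
    rw [hp, map_zero] at hb
    have : b = 0 := (mul_eq_zero.mp hb).resolve_right hr
    simp [this]
  obtain ⟨e', p₀, he', rfl, hu'⟩ := p.exists_eq_C_mul_isUnit_coeff hp
  rw [map_mul, map_mul, coe_eval₂RingHom, eval₂_C, eval₂_C] at hb
  have hdvd : f e ∣ f e' := by
    rw [← (hζ p₀ hu').dvd_mul_right, ← hb]
    exact ⟨b * eval₂ f ζ r₀, by ring⟩
  obtain ⟨c, rfl⟩ := hf.dvd_of_dvd hdvd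
  refine ⟨C c * p₀, r₀, hζ r₀ hu, ?_⟩
  have he0 : f e ≠ 0 := fun h => he (hf.inj (h.trans (map_zero f).symm))
  apply mul_left_cancel₀ he0
  change f e * (b * eval₂ f ζ r₀) = _
  rw [map_mul, coe_eval₂RingHom, eval₂_C]
  rw [map_mul] at hb
  linear_combination hb

end RingHom

section

open Polynomial

theorem Polynomial.exists_isUnit_coeff_iff {W : Type*} [CommRing W] [IsLocalRing W] (p : W[X]) :
    (∃ m, IsUnit (p.coeff m)) ↔ p.map (IsLocalRing.residue W) ≠ 0 := by
  rw [Ne, Polynomial.ext_iff, not_forall]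
  simp

theorem Polynomial.exists_isUnit_coeff_mul {W : Type*} [CommRing W] [IsLocalRing W] {p r : W[X]}
    (hp : ∃ m, IsUnit (p.coeff m)) (hr : ∃ m, IsUnit (r.coeff m)) :
    ∃ m, IsUnit ((p * r).coeff m) := by
  rw [exists_isUnit_coeff_iff] at *
  rw [Polynomial.map_mul]
  exact mul_ne_zero hp hr

theorem Polynomial.exists_isUnit_coeff_of_isUnit_eval {W : Type*} [CommRing W] [IsLocalRing W]
    {p : W[X]} {z : W} (h : IsUnit (p.eval z)) : ∃ m, IsUnit (p.coeff m) := by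
  rw [exists_isUnit_coeff_iff]
  intro h0
  have := h.map (IsLocalRing.residue W)
  rw [← eval_map_apply, h0, eval_zero] at this
  exact not_isUnit_zero this

theorem Polynomial.exists_nat_isUnit_eval {W : Type*} [CommRing W] [IsLocalRing W]
    (hQ : ∀ n : ℕ, n ≠ 0 → IsUnit (n : W)) {p : W[X]} (hp : ∃ m, IsUnit (p.coeff m)) :
    ∃ n : ℕ, IsUnit (p.eval (n : W)) := by
  rw [exists_isUnit_coeff_iff] at hp
  have : CharZero (IsLocalRing.ResidueField W) := by
    refine charZero_of_inj_zero fun n hn => ?_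
    by_contra h
    have := (hQ n h).map (IsLocalRing.residue W)
    rw [map_natCast, hn] at this
    exact not_isUnit_zero this
  by_contra! h
  refine hp (eq_zero_of_infinite_isRoot _ ((Set.infinite_range_of_injective
    (Nat.cast_injective (R := IsLocalRing.ResidueField W))).mono ?_))
  rintro _ ⟨n, rfl⟩
  change eval _ _ = 0
  have := h n
  rw [← map_natCast (IsLocalRing.residue W), eval_map_apply, IsLocalRing.residue_eq_zero_iff]
  exact this

theorem Polynomial.eval₂_derivative_reflect {R S : Type*} [CommRing R] [CommRing S] (f : R →+* S)
    {x y : S} (hxy : x * y = 1) (N : ℕ) (p : R[X]) (hp : p.natDegree ≤ N) :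
    eval₂ f y (derivative (reflect N p)) * x ^ N =
      x * (N * eval₂ f x p - x * eval₂ f x (derivative p)) := by
  refine Polynomial.induction_with_natDegree_le
    (fun p => eval₂ f y (derivative (reflect N p)) * x ^ N =
      x * (N * eval₂ f x p - x * eval₂ f x (derivative p))) N (by simp) ?_ ?_ p hp
  · intro n r _ hn
    obtain ⟨k, rfl⟩ := Nat.exists_eq_add_of_le hn
    rw [reflect_C_mul_X_pow, revAt_le hn, Nat.add_sub_cancel_left]
    have h1 : x * eval₂ f x (derivative (C r * X ^ n)) = n * (f r * x ^ n) := by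
      rcases n with _ | n
      · simp
      · simp [eval₂_mul, eval₂_pow]; ring
    rw [h1]
    rcases k with _ | k
    · simp
    · have h2 : x ^ k * y ^ k = 1 := by rw [← mul_pow, hxy, one_pow]
      simp [eval₂_mul, eval₂_pow]
      linear_combination (f r * (k + 1) * x ^ (n + 1)) * h2
  · intro p q _ _ hp hq
    rw [reflect_add, derivative_add, derivative_add, eval₂_add, eval₂_add, eval₂_add, add_mul, hp,
      hq]
    ring

theorem Polynomial.exists_aeval_derivative_mul_eq {A S B : Type*} [CommRing A]
    [CommRing S] [CommRing B] [Algebra A S] [Algebra A B] [Algebra S B] [IsScalarTower A S B]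
    (hA : ∀ x : S, IsIntegral A x → ∃ a, algebraMap A S a = x) {z u : B} {f : A[X]}
    (hf : f.Monic) (hu : IsIntegral A u)
    (hsurj : Function.Surjective (aeval z : S[X] →ₐ[S] B))
    (hker : ∀ p : S[X], aeval z p = 0 ↔ f.map (algebraMap A S) ∣ p) :
    ∃ g : A[X], aeval z (derivative f) * u = aeval z g := by
  obtain ⟨g, hg, hgi⟩ := exists_derivative_mul_eq_and_isIntegral_coeff (R := A)
    (φ := (aeval z : S[X] →ₐ[S] B).restrictScalars A) hsurj (hf.map (algebraMap A S))
      (fun i => by rw [coeff_map]; exact isIntegral_algebraMap)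
    (by ext p; rw [Ideal.mem_span_singleton, ← hker]; rfl) hu
  have : ∃ g₀ : A[X], g₀.map (algebraMap A S) = g := by
    rw [← mem_lifts, lifts_iff_coeff_lifts]
    exact fun i => hA _ (hgi i)
  obtain ⟨g₀, rfl⟩ := this
  exact ⟨g₀, by rwa [derivative_map, AlgHom.restrictScalars_apply,
    AlgHom.restrictScalars_apply, aeval_map_algebraMap, aeval_map_algebraMap] at hg⟩

theorem Polynomial.exists_aeval_derivative_minpoly_mul_eq {A K B : Type*} [CommRing A]
    [IsDomain A] [IsIntegrallyClosed A] [Field K] [CommRing B] [Algebra A K] [IsFractionRing A K]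
    [IsDomain B] [Algebra A B] [Algebra K B] [IsScalarTower A K B] {z u : B}
    (hz : IsIntegral A z) (hu : IsIntegral A u)
    (hsurj : Function.Surjective (aeval z : K[X] →ₐ[K] B)) :
    ∃ g : A[X], aeval z (derivative (minpoly A z)) * u = aeval z g := by
  have hzK : IsIntegral K z := hz.tower_top
  have : Module.IsTorsionFree A B := by
    have : FaithfulSMul A B := (faithfulSMul_iff_algebraMap_injective A B).mpr (by
      rw [IsScalarTower.algebraMap_eq A K B]
      exact (algebraMap K B).injective.comp (IsFractionRing.injective A K))
    infer_instance
  have hmin : minpoly K z = (minpoly A z).map (algebraMap A K) :=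
    minpoly.isIntegrallyClosed_eq_field_fractions' K hz
  refine exists_aeval_derivative_mul_eq (fun x hx => IsIntegrallyClosed.isIntegral_iff.mp hx)
    (minpoly.monic hz) hu hsurj fun p => ?_
  rw [← hmin]
  exact (minpoly.dvd_iff).symm

theorem Polynomial.exists_aeval_derivative_minpoly_mul_eq_of_mul_eq {A W : Type*}
    [CommRing A] [IsDomain A]
    [IsIntegrallyClosed A] [CommRing W] [IsDomain W] [Algebra A W]
    (hinj : Function.Injective (algebraMap A W)) {z u : W} (hz : IsIntegral A z)
    (hu : IsIntegral A u) {p r : A[X]} (hr : aeval z r ≠ 0) (h : u * aeval z r = aeval z p) :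
    ∃ g : A[X], aeval z (derivative (minpoly A z)) * u = aeval z g := by
  let K := FractionRing A
  let L := FractionRing W
  have : FaithfulSMul A W := (faithfulSMul_iff_algebraMap_injective A W).mpr hinj
  have hAL : Function.Injective (algebraMap A L) := by
    rw [IsScalarTower.algebraMap_eq A W L]
    exact (IsFractionRing.injective W L).comp hinj
  have : FaithfulSMul A L := (faithfulSMul_iff_algebraMap_injective A L).mpr hAL
  let : Algebra K L := FractionRing.liftAlgebra A L
  have : IsScalarTower A K L := FractionRing.isScalarTower_liftAlgebra A L
  let zL : L := algebraMap W L z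
  have hzK : IsIntegral K zL := (hz.algebraMap (B := L)).tower_top
  let φ : K[X] →ₐ[K] L := aeval zL
  have hmap (p : A[X]) : φ (p.map (algebraMap A K)) = algebraMap W L (aeval z p) := by
    simp [φ, zL, aeval_algebraMap_apply]
  have hmem : algebraMap W L u ∈ φ.range := by
    have h1 : algebraMap W L u = algebraMap W L (aeval z p) * (algebraMap W L (aeval z r))⁻¹ := by
      rw [eq_mul_inv_iff_mul_eq₀, ← map_mul, h]
      exact (map_ne_zero_iff _ (IsFractionRing.injective W L)).mpr hr
    rw [h1, ← hmap, ← hmap]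
    have h2 (q : K[X]) : IsIntegral K (φ q) := by
      have := (aeval (R := K) (⟨zL, hzK⟩ : integralClosure K L) q).2
      rwa [← Subalgebra.aeval_coe] at this
    exact mul_mem ⟨_, rfl⟩ (Subalgebra.inv_mem_of_algebraic φ.range
      (x := (⟨φ (r.map (algebraMap A K)), ⟨_, rfl⟩⟩ : φ.range)) (h2 _).isAlgebraic)
  have hval : Function.Injective (φ.range.val.restrictScalars A) := Subtype.val_injective
  let zB : φ.range := ⟨zL, ⟨X, aeval_X zL⟩⟩
  let uB : φ.range := ⟨_, hmem⟩
  have hzB : IsIntegral A zB :=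
    (isIntegral_algHom_iff (φ.range.val.restrictScalars A) (x := zB) hval).mp
      (hz.algebraMap (B := L))
  have huB : IsIntegral A uB :=
    (isIntegral_algHom_iff (φ.range.val.restrictScalars A) (x := uB) hval).mp
      (hu.algebraMap (B := L))
  have hsurj : Function.Surjective (aeval zB : K[X] →ₐ[K] φ.range) := by
    rintro ⟨_, q, rfl⟩
    refine ⟨q, Subtype.ext ?_⟩
    exact (aeval_algHom_apply φ.range.val zB q).symm
  obtain ⟨g, hg⟩ := exists_aeval_derivative_minpoly_mul_eq (K := K) hzB huB hsurj
  refine ⟨g, IsFractionRing.injective W L ?_⟩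
  have h3 : minpoly A zB = minpoly A z := by
    rw [← minpoly.algebraMap_eq (B := W) (B' := L) (IsFractionRing.injective W L)]
    exact (minpoly.algHom_eq (φ.range.val.restrictScalars A) hval zB).symm
  have h4 (q : A[X]) : φ.range.val (aeval zB q) = algebraMap W L (aeval z q) := by
    rw [← aeval_algebraMap_apply]
    exact (aeval_algHom_apply (φ.range.val.restrictScalars A) zB q).symm
  have h5 := congrArg φ.range.val hg
  rw [map_mul, h4, h4, h3] at h5
  rw [map_mul]
  exact h5

theorem exists_isIntegral_mul_of_isAlgebraic {A W : Type*} [CommRing A] [IsDomain A]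
    [CommRing W] [IsDomain W] [IsLocalRing W] [Algebra A W] {w : W}
    {p : A[X]} (hp : aeval w p = 0) (hu : ∃ m, IsUnit (algebraMap A W (p.coeff m))) :
    ∃ r : A[X], IsIntegral A (aeval w r) ∧ IsIntegral A (w * aeval w r) ∧
      IsUnit (aeval w r) := by
  classical
  let s : ℕ → A[X] := fun j => divX^[j] p
  have hs' (j) : s (j + 1) = divX (s j) := Function.iterate_succ_apply' _ _ _
  have hcoeff (j) : ∀ i, (s j).coeff i = p.coeff (i + j) := by
    induction j with
    | zero => intro i; rfl
    | succ j ih => intro i; rw [hs', coeff_divX, ih]; congr 1; omega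
  have hs (j) : s j = s (j + 1) * X + C (p.coeff j) := by
    have := hcoeff j 0
    rw [zero_add] at this
    rw [← this, hs', divX_mul_X_add]
  let b : ℕ → W := fun j => aeval w (s j)
  have hb (j) : b j = b (j + 1) * w + algebraMap A W (p.coeff j) := by
    simp only [b]
    rw [hs j]
    simp
  have hb0 : b 0 = 0 := hp
  let M : Submodule A W := (degreeLT A (p.natDegree + 1)).map (aeval w).toLinearMap
  have hMmem {r : A[X]} (hr : r.natDegree < p.natDegree + 1) : aeval w r ∈ M :=
    ⟨r, mem_degreeLT.mpr (degree_le_natDegree.trans_lt (by exact_mod_cast hr)), rfl⟩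
  have hpow {k : ℕ} (hk : k < p.natDegree + 1) : w ^ k ∈ M := by
    have := hMmem (r := X ^ k) (natDegree_X_pow_le k |>.trans_lt hk)
    simpa using this
  have hmem : ∀ k < p.natDegree + 1, ∀ j, b j * w ^ k ∈ M := by
    intro k
    induction k with
    | zero =>
      intro _ j
      rw [pow_zero, mul_one]
      refine hMmem (Nat.lt_succ_of_le ?_)
      rw [natDegree_le_iff_coeff_eq_zero]
      intro i hi
      rw [hcoeff]
      exact coeff_eq_zero_of_natDegree_lt (by omega)
    | succ k ih =>
      intro hk j
      rcases j with _ | j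
      · rw [hb0, zero_mul]
        exact M.zero_mem
      · have : b (j + 1) * w ^ (k + 1) = b j * w ^ k - p.coeff j • w ^ k := by
          rw [hb j, Algebra.smul_def]; ring
        rw [this]
        exact M.sub_mem (ih (by omega) j) (M.smul_mem _ (hpow (by omega)))
  have hbint (j) : IsIntegral A (b j) := by
    refine isIntegral_of_smul_mem_submodule M ?_ ?_ (b j) ?_
    · intro h
      have := hpow (k := 0) (by omega)
      rw [h, pow_zero, Submodule.mem_bot] at this
      exact one_ne_zero this
    · refine Submodule.FG.map _ ?_
      rw [degreeLT_eq_span_X_pow]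
      exact ⟨_, rfl⟩
    · rintro _ ⟨r, hr, rfl⟩
      change b j * aeval w r ∈ M
      rw [aeval_eq_sum_range, Finset.mul_sum]
      refine M.sum_mem fun k hk => ?_
      rw [mul_smul_comm]
      by_cases hk' : k < p.natDegree + 1
      · exact M.smul_mem _ (hmem _ hk' j)
      · rw [coeff_eq_zero_of_degree_lt ((mem_degreeLT.mp hr).trans_le (by
          exact_mod_cast not_lt.mp hk')), zero_smul]
        exact M.zero_mem
  have : ∃ j, IsUnit (b (j + 1)) := by
    by_contra! h
    have hn : ∀ j, b j ∈ nonunits W := by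
      rintro (_ | j)
      · rw [hb0]; exact not_isUnit_zero
      · exact h j
    obtain ⟨m, hm⟩ := hu
    have h1 : algebraMap A W (p.coeff m) = b m - b (m + 1) * w := by rw [hb m]; ring
    rw [h1] at hm
    have : b m - b (m + 1) * w ∈ IsLocalRing.maximalIdeal W :=
      Ideal.sub_mem _ (hn m) (Ideal.mul_mem_right _ _ (hn (m + 1)))
    exact this hm
  obtain ⟨j, hj⟩ := this
  refine ⟨s (j + 1), hbint _, ?_, hj⟩
  have : w * aeval w (s (j + 1)) = b j - algebraMap A W (p.coeff j) := by
    rw [hb]; ring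
  rw [this]
  exact (hbint j).sub isIntegral_algebraMap

end

section

open Polynomial

namespace RingHom

theorem divClosure_le {R R' W : Type*} [CommRing R] [CommRing R'] [CommRing W] [IsDomain W]
    {g : R →+* W} {g' : R' →+* W} (h : ∀ r, g r ∈ g'.divClosure) :
    g.divClosure ≤ g'.divClosure := by
  rintro w ⟨p, r, hr, hw⟩
  exact g'.mem_divClosure_of_mul_mem (h r) hr (hw ▸ h p)

theorem eval₂_mem_divClosure {A R W : Type*} [CommRing A] [CommRing R] [CommRing W] [IsDomain W]
    {g : R →+* W} {f : A →+* W} (hf : ∀ a, f a ∈ g.divClosure) {z : W} (hz : z ∈ g.divClosure)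
    (p : A[X]) : p.eval₂ f z ∈ g.divClosure := by
  rw [eval₂_eq_sum_range]
  exact sum_mem fun i _ => mul_mem (hf _) (pow_mem hz i)

theorem Immediate.indSm_of_monic {A W : Type v} [CommRing A] [CommRing W] [IsDomain W]
    [ValuationRing W] {f : A →+* W} (hf : f.Immediate) {z : W} {F : A[X]} (hF : F.Monic)
    (h0 : F.eval₂ f z = 0) (h1 : IsUnit (F.derivative.eval₂ f z)) (D : Subring W)
    (hD : D = (eval₂RingHom f z).divClosure) (f' : A →+* D) (hf' : D.subtype.comp f' = f) :
    f'.IndSm := by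
  subst hD
  have := hf.isDomain
  have := hf.valuationRing
  let : Algebra A W := f.toAlgebra
  have : FaithfulSMul A W := (faithfulSMul_iff_algebraMap_injective A W).mpr hf.inj
  have hz : _root_.IsIntegral A z := ⟨F, hF, h0⟩
  let f₀ := minpoly A z
  have hu : IsUnit (aeval z (derivative f₀)) := by
    obtain ⟨c, rfl⟩ := minpoly.isIntegrallyClosed_dvd hz h0
    rw [derivative_mul, eval₂_add, eval₂_mul, eval₂_mul] at h1
    have : eval₂ f z (minpoly A z) = 0 := minpoly.aeval A z
    rw [this, zero_mul, add_zero] at h1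
    exact isUnit_of_mul_isUnit_left h1
  let P : StandardEtalePair A := ⟨f₀, minpoly.monic hz, derivative f₀, ⟨1, 0, 1, by simp⟩⟩
  have hmap : P.HasMap z := ⟨minpoly.aeval A z, hu⟩
  let g := P.lift z hmap
  have hg (p : A[X]) : g (aeval P.X p) = aeval z p := by
    rw [← aeval_algHom_apply, P.lift_X]
  have hX : IsUnit (aeval P.X (derivative f₀)) := P.hasMap_X.2
  have hrep (s : P.Ring) : ∃ (n : ℕ) (p : A[X]),
    s * aeval P.X (derivative f₀) ^ n = aeval P.X p := by
    let e := P.equivAwayAdjoinRoot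
    have heX : e P.X = algebraMap (AdjoinRoot P.f) _ (.root P.f) := by
      refine P.lift_X _ ⟨?_, ?_⟩
      · rw [aeval_algebraMap_apply, AdjoinRoot.aeval_eq, AdjoinRoot.mk_self, map_zero]
      · rw [aeval_algebraMap_apply, AdjoinRoot.aeval_eq]
        exact IsLocalization.Away.algebraMap_isUnit _
    have he (p : A[X]) : e (aeval P.X p) = algebraMap (AdjoinRoot P.f) _ (AdjoinRoot.mk P.f p) := by
      refine (aeval_algHom_apply e.toAlgHom P.X p).symm.trans ?_
      change aeval (e P.X) p = _
      rw [heX, aeval_algebraMap_apply, AdjoinRoot.aeval_eq]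
    obtain ⟨x, ⟨_, n, rfl⟩, hx⟩ := IsLocalization.exists_mk'_eq
      (Submonoid.powers (AdjoinRoot.mk P.f P.g)) (e s)
    obtain ⟨p, rfl⟩ := AdjoinRoot.mk_surjective x
    refine ⟨n, p, e.injective ?_⟩
    rw [map_mul, map_pow, he, he, ← hx, ← map_pow]
    exact IsLocalization.mk'_spec _ _ _
  have hmem (p : A[X]) : aeval z p ∈ (eval₂RingHom f z).divClosure := apply_mem_divClosure _ p
  refine indSm_of_fractions f _ (fun r hr hu w hw => mem_divClosure_of_mul_mem _ hr hu.ne_zero hw)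
    _ hf' fun Y => ⟨P.Ring, inferInstance, inferInstance, g, inferInstance, ?_,
      by ext a; exact g.commutes a, ?_, ?_⟩
  · rw [injective_iff_map_eq_zero]
    intro s hs
    obtain ⟨n, p, hp⟩ := hrep s
    have := congrArg g hp
    change g s = 0 at hs
    rw [map_mul, hs, zero_mul, hg, eq_comm] at this
    obtain ⟨c, rfl⟩ := minpoly.isIntegrallyClosed_dvd hz this
    rw [map_mul, P.hasMap_X.1, zero_mul] at hp
    exact (hX.pow n).mul_left_eq_zero.mp hp
  · intro s
    obtain ⟨n, p, hp⟩ := hrep s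
    have := congrArg g hp
    rw [map_mul, map_pow, hg, hg] at this
    refine mem_divClosure_of_mul_mem _ (pow_mem (hmem (derivative f₀)) n) (hu.pow n).ne_zero ?_
    change g s * _ ∈ _
    rw [this]
    exact hmem p
  · rintro ⟨w, p, r, hr, hw⟩ -
    have hr' : aeval z r ≠ 0 := hr
    have hw' : w * aeval z r = aeval z p := hw
    have hzalg (q : A[X]) : IsAlgebraic A (aeval z q) := by
      have := (aeval (R := A) (⟨z, hz⟩ : integralClosure A W) q).2
      rw [← Subalgebra.aeval_coe] at this
      exact IsIntegral.isAlgebraic this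
    have hwalg : IsAlgebraic A w := by
      refine IsAlgebraic.of_mul (mem_nonZeroDivisors_of_ne_zero hr') (hzalg r) ?_
      rw [mul_comm, hw']
      exact hzalg p
    obtain ⟨φ, hφ0, hφ⟩ := hwalg
    obtain ⟨e, φ₁, he, rfl, m, hm⟩ := φ.exists_eq_C_mul_isUnit_coeff hφ0
    rw [map_mul, aeval_C] at hφ
    have hφ₁ : aeval w φ₁ = 0 := (mul_eq_zero.mp hφ).resolve_left
      fun h => he (hf.inj (h.trans (map_zero f).symm))
    obtain ⟨b, hb, hwb, hbu⟩ := exists_isIntegral_mul_of_isAlgebraic hφ₁ ⟨m, hm.map _⟩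
    have hfr {y : W} (hy : y ∈ (eval₂RingHom f z).divClosure) (hyi : _root_.IsIntegral A y) :
        ∃ g : A[X], aeval z (derivative (minpoly A z)) * y = aeval z g := by
      obtain ⟨p', r', hr', h'⟩ := hy
      exact exists_aeval_derivative_minpoly_mul_eq_of_mul_eq hf.inj hz hyi hr' h'
    have hwD : w ∈ (eval₂RingHom f z).divClosure := ⟨p, r, hr, hw⟩
    have hbD : aeval w b ∈ (eval₂RingHom f z).divClosure :=
      eval₂_mem_divClosure (fun a => by simpa using hmem (C a)) hwD b
    obtain ⟨g₁, hg₁⟩ := hfr hbD hb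
    obtain ⟨g₂, hg₂⟩ := hfr (mul_mem hwD hbD) hwb
    refine ⟨aeval P.X g₂, aeval P.X g₁, ?_, ?_⟩
    · change IsUnit (g (aeval P.X g₁))
      rw [hg, ← hg₁]
      exact hu.mul hbu
    · change w * g (aeval P.X g₁) = g (aeval P.X g₂)
      rw [hg, hg, ← hg₁, ← hg₂]
      ring

theorem Immediate.indSm_of_isUnit_derivative {A W : Type v} [CommRing A] [CommRing W] [IsDomain W]
    [ValuationRing W] {f : A →+* W} (hf : f.Immediate) (hQ : ∀ n : ℕ, n ≠ 0 → IsUnit (n : W))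
    {z : W} {Φ : A[X]} (h0 : Φ.eval₂ f z = 0) (h1 : IsUnit (Φ.derivative.eval₂ f z)) :
    ((eval₂RingHom f z).toDivClosure.comp C).IndSm := by
  have := hf.isDomain
  have := hf.valuationRing
  have hm : ∃ m, IsUnit ((Φ.map f).coeff m) := by
    rw [← eval_map, ← derivative_map] at h1
    obtain ⟨m, hm⟩ := exists_isUnit_coeff_of_isUnit_eval h1
    rw [coeff_derivative] at hm
    exact ⟨_, isUnit_of_mul_isUnit_left hm⟩
  obtain ⟨n, hn⟩ := exists_nat_isUnit_eval hQ (p := Φ.map f * (X - C z))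
    (exists_isUnit_coeff_mul hm ⟨1, by simp⟩)
  rw [eval_mul, eval_sub, eval_X, eval_C] at hn
  have hn1 : IsUnit (Φ.eval (n : A)) := by
    refine hf.isUnit ?_
    rw [← eval₂_at_natCast, ← eval_map]
    exact isUnit_of_mul_isUnit_left hn
  have hn2 := isUnit_of_mul_isUnit_right hn
  let x : W := z - n
  obtain ⟨y, hxy⟩ : ∃ y, x * y = 1 := by
    have := hn2.neg.exists_right_inv
    simpa [x] using this
  have hxu : IsUnit x := IsUnit.of_mul_eq_one _ hxy
  let Ψ := taylor (n : A) Φ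
  have hΨ (p : A[X]) : (taylor (n : A) p).eval₂ f x = p.eval₂ f z := by
    rw [taylor_apply, eval₂_comp]
    simp [x]
  have hΨ0 : Ψ.coeff 0 = Φ.eval (n : A) := by simp [Ψ, taylor_coeff_zero]
  let F := C (↑hn1.unit⁻¹ : A) * reflect Ψ.natDegree Ψ
  have hFm : F.Monic := by
    have h : (reflect Ψ.natDegree Ψ).leadingCoeff = Φ.eval (n : A) := by
      rw [← hΨ0, ← trailingCoeff_eq_coeff_zero (by rw [hΨ0]; exact hn1.ne_zero)]
      exact reverse_leadingCoeff Ψ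
    refine monic_C_mul_of_mul_leadingCoeff_eq_one ?_
    rw [h, IsUnit.val_inv_mul]
  have hc : IsUnit (f (↑hn1.unit⁻¹ : A)) := (Units.isUnit _).map f
  have hF0 : F.eval₂ f y = 0 := by
    let : Invertible x := ⟨y, by rw [mul_comm, hxy], hxy⟩
    have := eval₂_reverse_mul_pow f x Ψ
    rw [hΨ, h0] at this
    have h2 : eval₂ f y (reflect Ψ.natDegree Ψ) = 0 :=
      (mul_eq_zero.mp this).resolve_right (pow_ne_zero _ hxu.ne_zero)
    rw [eval₂_mul, h2, mul_zero]
  have hF1 : IsUnit (F.derivative.eval₂ f y) := by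
    have := eval₂_derivative_reflect f hxy Ψ.natDegree Ψ le_rfl
    have hd : derivative Ψ = taylor (n : A) (derivative Φ) := by
      simp [Ψ, taylor_apply, derivative_comp]
    rw [hd, hΨ, hΨ, h0, mul_zero, zero_sub] at this
    rw [derivative_C_mul, eval₂_mul, eval₂_C]
    refine hc.mul (isUnit_of_mul_isUnit_left (y := x ^ Ψ.natDegree) ?_)
    rw [this]
    exact hxu.mul (hxu.mul h1).neg
  refine hf.indSm_of_monic hFm hF0 hF1 _ ?_ _ (by ext; simp)
  have hx : x ∈ (eval₂RingHom f z).divClosure := ⟨X - C (n : A), 1, by simp, by simp [x]⟩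
  have hy : y ∈ (eval₂RingHom f y).divClosure := by
    simpa using apply_mem_divClosure (eval₂RingHom f y) X
  have hC (w : W) (a : A) : f a ∈ (eval₂RingHom f w).divClosure := by
    simpa using apply_mem_divClosure (eval₂RingHom f w) (C a)
  have hx' : x ∈ (eval₂RingHom f y).divClosure :=
    mem_divClosure_of_mul_mem _ hy (right_ne_zero_of_mul_eq_one hxy) (hxy ▸ one_mem _)
  have hz' : z ∈ (eval₂RingHom f y).divClosure := by
    have : z = x + f n := by simp [x]
    rw [this]
    exact add_mem hx' (hC _ _)
  apply le_antisymm
  · exact divClosure_le fun p => eval₂_mem_divClosure (hC y) hz' p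
  · refine divClosure_le fun p => eval₂_mem_divClosure (hC z) ?_ p
    refine mem_divClosure_of_mul_mem _ hx hxu.ne_zero ?_
    rw [mul_comm, hxy]
    exact one_mem _

end RingHom

end

section

open Polynomial

namespace RingHom

theorem ExClosed.dvd_of_dvd {A B : Type v} [CommRing A] [CommRing B] {ι : A →+* B}
    (hι : ι.ExClosed) {a b : A} (h : ι a ∣ ι b) : a ∣ b := by
  obtain ⟨c, hc⟩ := h
  obtain ⟨y, hy⟩ := hι 1 {MvPolynomial.C a * MvPolynomial.X 0 - MvPolynomial.C b} (fun _ => c)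
    (by simp [hc])
  simp only [Finset.mem_singleton, forall_eq, map_sub, map_mul, MvPolynomial.eval_C,
    MvPolynomial.eval_X, sub_eq_zero] at hy
  exact ⟨y 0, hy.symm⟩

theorem Immediate.comp_exClosed {A W Ω : Type v} [CommRing A] [CommRing W] [CommRing Ω]
    [IsDomain Ω] {f : A →+* W} {ι : W →+* Ω} (hf : f.Immediate) (hι : ι.ExClosed)
    (h : ∀ w, ∃ a, Associated (ι a) w) : (ι.comp f).Immediate where
  inj := hι.injective.comp hf.inj
  exists_of_mul_eq a b c ha hc := by
    obtain ⟨d, hd⟩ := hf.dvd_of_dvd (hι.dvd_of_dvd (Dvd.intro _ hc))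
    refine ⟨d, mul_left_cancel₀ (a := ι (f a)) ?_ ?_⟩
    · exact fun h0 => ha (hf.inj (hι.injective (by simpa using h0)))
    · rw [RingHom.comp_apply, RingHom.comp_apply] at hc
      rw [hc, hd, map_mul, map_mul]
      rfl
  exists_associated w := by
    obtain ⟨w', hw'⟩ := h w
    obtain ⟨a, ha⟩ := hf.exists_associated w'
    exact ⟨a, (ha.map ι).trans hw'⟩

theorem exists_polynomial_gauss_extension {W : Type v} [CommRing W] [IsDomain W] [ValuationRing W]
    (hQ : ∀ n : ℕ, n ≠ 0 → IsUnit (n : W)) :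
    ∃ (Ω : Type v) (_ : CommRing Ω) (_ : IsDomain Ω) (_ : ValuationRing Ω) (ι : W →+* Ω) (T : Ω),
      ι.ExClosed ∧ (∀ w, ∃ a, Associated (ι a) w) ∧
      ∀ p : W[X], (∃ m, IsUnit (p.coeff m)) → IsUnit (p.eval₂ ι T) := by
  obtain ⟨Ω, _, _, _, ι, T, h1, h2, h3⟩ := exists_gauss_extension hQ PUnit.{v + 1}
  refine ⟨Ω, inferInstance, inferInstance, inferInstance, ι, T ⟨⟩, h1, h2, fun p hp => ?_⟩
  let P : MvPolynomial PUnit.{v + 1} W := p.eval₂ MvPolynomial.C (MvPolynomial.X ⟨⟩)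
  have hP : P.eval₂ ι T = p.eval₂ ι (T ⟨⟩) := by
    change MvPolynomial.eval₂Hom ι T (p.eval₂ _ _) = _
    rw [hom_eval₂]
    congr 1
    · ext a; simp
    · simp
  rw [← hP]
  refine h3 P ?_
  by_contra! h
  have hP0 : P.map (IsLocalRing.residue W) = 0 := by
    ext m
    rw [MvPolynomial.coeff_map, MvPolynomial.coeff_zero, IsLocalRing.residue_eq_zero_iff]
    exact h m
  refine (exists_isUnit_coeff_iff p).mp hp ?_
  have h4 : MvPolynomial.eval₂Hom (C.comp (IsLocalRing.residue W)) (fun _ => X) P =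
      p.map (IsLocalRing.residue W) := by
    rw [hom_eval₂, Polynomial.map]
    congr 1
    · ext a; simp
    · simp
  rw [← h4, MvPolynomial.coe_eval₂Hom, ← MvPolynomial.eval₂_map, hP0, MvPolynomial.eval₂_zero]

end RingHom

theorem Polynomial.exists_isUnit_coeff_comp {W : Type*} [CommRing W] [IsLocalRing W] {p q : W[X]}
    (hp : ∃ m, IsUnit (p.coeff m)) (hq : IsUnit (q.coeff 1)) :
    ∃ m, IsUnit ((p.comp q).coeff m) := by
  rw [exists_isUnit_coeff_iff] at *
  rw [map_comp, Ne, comp_eq_zero_iff, not_or]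
  refine ⟨hp, fun h => ?_⟩
  have h1 := hq.map (IsLocalRing.residue W)
  rw [← coeff_map, h.2, coeff_C_succ] at h1
  exact not_isUnit_zero h1

theorem Polynomial.exists_isUnit_eval_iterate_derivative {W : Type*} [CommRing W] [IsLocalRing W]
    (hQ : ∀ n : ℕ, n ≠ 0 → IsUnit (n : W)) {p : W[X]} (hp : ∃ m, IsUnit (p.coeff m)) (z : W) :
    ∃ k, IsUnit ((derivative^[k] p).eval z) := by
  by_contra! h
  have h1 : (taylor z p).map (IsLocalRing.residue W) = 0 := by
    ext k
    rw [coeff_map, coeff_zero, IsLocalRing.residue_eq_zero_iff]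
    intro hu
    refine h k ?_
    rw [← factorial_smul_hasseDeriv, LinearMap.smul_apply, eval_smul, nsmul_eq_mul]
    rw [taylor_coeff] at hu
    exact (hQ _ k.factorial_ne_zero).mul hu
  rw [exists_isUnit_coeff_iff] at hp
  rw [map_taylor] at h1
  exact hp ((map_eq_zero_iff _ (taylor_injective _)).mp h1)

theorem Polynomial.iterate_derivative_comp_C_add_C_mul_X {R : Type*} [CommRing R] (p : R[X])
    (a b : R) (k : ℕ) : derivative^[k] (p.comp (C a + C b * X)) =
      C (b ^ k) * (derivative^[k] p).comp (C a + C b * X) := by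
  induction k with
  | zero => simp
  | succ k ih =>
    rw [Function.iterate_succ_apply', ih, Function.iterate_succ_apply', derivative_C_mul,
      derivative_comp]
    simp only [derivative_add, derivative_C, derivative_C_mul, derivative_X, C_pow]
    ring

namespace RingHom

theorem Immediate.exists_indSm_affine {A W : Type v} [CommRing A] [CommRing W] [IsDomain W]
    [ValuationRing W] {f : A →+* W} (hf : f.Immediate) (hQ : ∀ n : ℕ, n ≠ 0 → IsUnit (n : W))
    (y : W) (g : A[X]) (h0 : g.eval₂ f y ≠ 0) (hu : ¬ IsUnit (g.eval₂ f y))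
    (h1 : IsUnit (g.derivative.eval₂ f y)) :
    ∃ (A' Ω : Type v) (_ : CommRing A') (_ : CommRing Ω) (_ : IsDomain Ω) (_ : ValuationRing Ω)
      (i : A →+* A') (f' : A' →+* Ω) (ι : W →+* Ω) (a : A') (c : A) (z : Ω),
      i.IndSm ∧ f'.Immediate ∧ ι.ExClosed ∧ f'.comp i = ι.comp f ∧
      ι y = f' a + f' (i c) * z ∧ c ≠ 0 ∧ Associated (f c) (g.eval₂ f y) := by
  obtain ⟨c, hc⟩ := hf.exists_associated (g.eval₂ f y)
  have hc0 : c ≠ 0 := by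
    rintro rfl
    rw [map_zero] at hc
    exact h0 ((associated_zero_iff_eq_zero _).mp hc.symm)
  have hcu : ¬ IsUnit (f c) := fun h => hu ((hc.isUnit_iff).mp h)
  obtain ⟨Ω, _, _, _, ι, T, hι, hass, hT⟩ := exists_polynomial_gauss_extension hQ
  have hf₁ := hf.comp_exClosed hι hass
  let x := ι y + ι (f c) * T
  obtain ⟨Q, hQ1, hQ2⟩ : ∃ Q : W[X], IsUnit (Q.coeff 1) ∧
      C (f c) * Q = (g.map f).comp (C y + C (f c) * X) := by
    obtain ⟨w, hw⟩ := hc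
    let τ := taylor y (g.map f)
    refine ⟨C (w : W) + X * (divX τ).comp (C (f c) * X), ?_, ?_⟩
    · rw [coeff_add, coeff_C_succ, coeff_X_mul, zero_add, coeff_zero_eq_eval_zero, eval_comp]
      simp only [eval_mul, eval_C, eval_X, mul_zero, ← coeff_zero_eq_eval_zero, coeff_divX]
      rwa [zero_add, taylor_coeff_one, derivative_map, eval_map]
    · have h : X * divX τ + C (τ.coeff 0) = τ := by rw [mul_comm]; exact divX_mul_X_add τ
      have h2 : τ.comp (C (f c) * X) = (g.map f).comp (C y + C (f c) * X) := by
        change (taylor y (g.map f)).comp _ = _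
        rw [taylor_apply, Polynomial.comp_assoc]
        simp [add_comm]
      rw [← h2]
      nth_rw 2 [← h]
      rw [taylor_coeff_zero, eval_map, ← hw]
      simp only [add_comp, mul_comp, X_comp, C_comp, C_mul]
      ring
  let ζ := Q.eval₂ ι T
  have hζ : ∀ p : A[X], (∃ m, IsUnit (p.coeff m)) → IsUnit (p.eval₂ (ι.comp f) ζ) := by
    intro p hp
    have h : p.eval₂ (ι.comp f) ζ = ((p.map f).comp Q).eval₂ ι T := by
      rw [eval₂_comp, eval₂_map]
    rw [h]
    refine hT _ (exists_isUnit_coeff_comp ?_ hQ1)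
    obtain ⟨m, hm⟩ := hp
    exact ⟨m, by rw [coeff_map]; exact hm.map f⟩
  have hcζ : ι (f c) * ζ = g.eval₂ (ι.comp f) x := by
    have h := congr_arg (eval₂ ι T) hQ2
    rwa [eval₂_mul, eval₂_C, eval₂_comp, eval₂_map, eval₂_add, eval₂_mul, eval₂_C, eval₂_C,
      eval₂_X] at h
  have hgx : IsUnit (g.derivative.eval₂ (ι.comp f) x) := by
    have h2 : IsUnit (g.derivative.eval₂ (ι.comp f) (ι y)) := by
      rw [← hom_eval₂]
      exact h1.map ι
    have h3 : ι (f c) ∣ g.derivative.eval₂ (ι.comp f) x - g.derivative.eval₂ (ι.comp f) (ι y) := by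
      rw [← eval_map, ← eval_map]
      refine dvd_trans ⟨T, ?_⟩ (sub_dvd_eval_sub x (ι y) _)
      simp [x]
    by_contra h4
    have h5 : ι (f c) ∈ IsLocalRing.maximalIdeal Ω := by
      refine fun h => hcu ?_
      obtain ⟨d, hd⟩ := hι.dvd_of_dvd (a := f c) (b := 1) h.dvd
      exact .of_mul_eq_one _ hd.symm
    have h6 := Ideal.sub_mem _ ((IsLocalRing.mem_maximalIdeal _).mpr h4) (Ideal.mem_of_dvd _ h3 h5)
    rw [sub_sub_cancel] at h6
    exact h6 h2
  let g₁ := eval₂RingHom (ι.comp f) ζ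
  let A₁ := g₁.divClosure
  have hA₁ : A₁.subtype.Immediate := hf₁.divClosure g₁ C (by ext; simp [g₁])
  let i₁ : A →+* A₁ := g₁.toDivClosure.comp C
  have hi₁ : i₁.IndSm := hf₁.indSm_of_isUnit ζ hζ
  have hi₁' : A₁.subtype.comp i₁ = ι.comp f := by ext; simp [i₁, g₁]
  let ζ₁ : A₁ := g₁.toDivClosure X
  have hζ₁ : A₁.subtype ζ₁ = ζ := by simp [ζ₁, g₁]
  let Φ : A₁[X] := C (i₁ c * ζ₁) - g.map i₁
  have hΦ0 : Φ.eval₂ A₁.subtype x = 0 := by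
    rw [eval₂_sub, eval₂_C, eval₂_map, hi₁', map_mul, hζ₁, ← RingHom.comp_apply, hi₁', ← hcζ]
    simp
  have hΦ1 : IsUnit (Φ.derivative.eval₂ A₁.subtype x) := by
    rw [derivative_sub, derivative_C, zero_sub, eval₂_neg, derivative_map, eval₂_map, hi₁']
    exact hgx.neg
  have hQΩ : ∀ n : ℕ, n ≠ 0 → IsUnit (n : Ω) := fun n hn => by simpa using (hQ n hn).map ι
  let g₂ := eval₂RingHom A₁.subtype x
  let A₂ := g₂.divClosure
  have hA₂ : A₂.subtype.Immediate := hA₁.divClosure g₂ C (by ext; simp [g₂])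
  let i₂ : A₁ →+* A₂ := g₂.toDivClosure.comp C
  have hi₂ : i₂.IndSm := hA₁.indSm_of_isUnit_derivative hQΩ hΦ0 hΦ1
  have hi₂' : A₂.subtype.comp i₂ = A₁.subtype := by ext; simp [i₂, g₂]
  have hcomp : A₂.subtype.comp (i₂.comp i₁) = ι.comp f := by rw [← comp_assoc, hi₂', hi₁']
  refine ⟨A₂, Ω, inferInstance, inferInstance, inferInstance, inferInstance, i₂.comp i₁,
    A₂.subtype, ι, g₂.toDivClosure X, c, -T, hi₂.comp hi₁, hA₂, hι, hcomp, ?_, hc0, hc⟩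
  have h : A₂.subtype (i₂ (i₁ c)) = ι (f c) := RingHom.congr_fun hcomp c
  simp [h, g₂, x]

end RingHom

end

section

open Polynomial

namespace RingHom

theorem IndSm.id (A : Type v) [CommRing A] : (RingHom.id A).IndSm := .of_smooth A A

theorem Immediate.exists_chart (μ : ℕ) {A W : Type v} [CommRing A] [CommRing W] [IsDomain W]
    [ValuationRing W] {f : A →+* W} (hf : f.Immediate) (hQ : ∀ n : ℕ, n ≠ 0 → IsUnit (n : W))
    (y : W) (F : A[X]) (hF : IsUnit ((derivative^[μ] F).eval₂ f y)) :
    ∃ (A' Ω : Type v) (_ : CommRing A') (_ : CommRing Ω) (_ : IsDomain Ω) (_ : ValuationRing Ω)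
      (i : A →+* A') (f' : A' →+* Ω) (ι : W →+* Ω),
      i.IndSm ∧ f'.Immediate ∧ ι.ExClosed ∧ f'.comp i = ι.comp f ∧
      ((∃ a, f' a = ι y) ∨ ∃ (a b : A') (z : Ω) (e : A') (G : A'[X]), ι y = f' a + f' b * z ∧
        e ≠ 0 ∧ (F.map i).comp (C a + C b * X) = C e * G ∧ IsUnit (G.eval₂ f' z)) := by
  induction μ using Nat.strong_induction_on generalizing A W with
  | _ μ ih =>
  obtain _ | μ := μ
  · have := hf.isDomain
    exact ⟨A, W, inferInstance, inferInstance, inferInstance, inferInstance, .id A, f, .id W,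
      .id A, hf, .id W, rfl, .inr ⟨0, 1, y, 1, F, by simp, one_ne_zero, by simp, hF⟩⟩
  let g := derivative^[μ] F
  by_cases hgu : IsUnit (g.eval₂ f y)
  · exact ih μ μ.lt_succ_self hf hQ y F hgu
  rw [Function.iterate_succ_apply'] at hF
  by_cases hg0 : g.eval₂ f y = 0
  · let g₁ := eval₂RingHom f y
    refine ⟨g₁.divClosure, W, inferInstance, inferInstance, inferInstance, inferInstance,
      g₁.toDivClosure.comp C, g₁.divClosure.subtype, .id W,
      hf.indSm_of_isUnit_derivative hQ hg0 hF, hf.divClosure g₁ C (by ext; simp [g₁]), .id W,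
      by ext; simp [g₁], .inl ⟨g₁.toDivClosure X, by simp [g₁]⟩⟩
  obtain ⟨A₂, Ω, _, _, _, _, i, f', ι, a₀, c, z, hi, hf', hι, hcomp, hy, hc0, hc⟩ :=
    hf.exists_indSm_affine hQ y g hg0 hgu hF
  have := hf'.isDomain
  have := hf'.valuationRing
  have hQΩ : ∀ n : ℕ, n ≠ 0 → IsUnit (n : Ω) := fun n hn => by simpa using (hQ n hn).map ι
  let F₂ := (F.map i).comp (C a₀ + C (i c) * X)
  have hd0 : f' (i c) ≠ 0 := by
    rw [← RingHom.comp_apply, hcomp]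
    exact fun h => hc0 (hf.inj (hι.injective (by simpa using h)))
  have hF₂ (k : ℕ) : (derivative^[k] F₂).eval₂ f' z =
      f' (i c) ^ k * ι ((derivative^[k] F).eval₂ f y) := by
    rw [iterate_derivative_comp_C_add_C_mul_X, eval₂_mul, eval₂_C, map_pow, eval₂_comp,
      iterate_derivative_map, eval₂_map, hcomp, hom_eval₂]
    congr 2
    simp [hy]
  have hF₂0 : F₂ ≠ 0 := by
    intro h
    have h1 := hF₂ (μ + 1)
    rw [h, iterate_derivative_zero, eval₂_zero, Function.iterate_succ_apply'] at h1
    exact mul_ne_zero (pow_ne_zero _ hd0) (hF.map ι).ne_zero h1.symm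
  obtain ⟨e, G, he, hG, hGu⟩ := exists_eq_C_mul_isUnit_coeff F₂ hF₂0
  have heG (k : ℕ) : f' e * (derivative^[k] G).eval₂ f' z =
      f' (i c) ^ k * ι ((derivative^[k] F).eval₂ f y) := by
    rw [← hF₂, hG, iterate_derivative_C_mul, eval₂_mul, eval₂_C]
  obtain ⟨k, hk⟩ := exists_isUnit_eval_iterate_derivative hQΩ (p := G.map f')
    (hGu.imp fun m hm => by rw [coeff_map]; exact hm.map f') z
  rw [iterate_derivative_map, eval_map] at hk
  obtain ⟨ν, hν, hGν⟩ : ∃ ν < μ + 1, IsUnit ((derivative^[ν] G).eval₂ f' z) := by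
    rcases lt_or_ge k (μ + 1) with h | h
    · exact ⟨k, h, hk⟩
    refine ⟨μ, μ.lt_succ_self, isUnit_of_dvd_unit ?_ hk⟩
    refine (mul_dvd_mul_iff_left (a := f' e) fun h0 => he (hf'.inj (by simpa using h0))).mp ?_
    rw [heG, heG]
    refine Dvd.dvd.mul_right (dvd_trans ?_ (pow_dvd_pow _ h)) _
    rw [pow_succ]
    refine mul_dvd_mul_left _ ?_
    rw [← RingHom.comp_apply, hcomp]
    exact map_dvd ι hc.symm.dvd
  obtain ⟨A', Ω', _, _, _, _, i', f'', ι', hi', hf'', hι', hcomp', h⟩ :=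
    ih ν hν hf' hQΩ z G hGν
  have h' (a : A₂) : f'' (i' a) = ι' (f' a) := RingHom.congr_fun hcomp' a
  refine ⟨A', Ω', inferInstance, inferInstance, inferInstance, inferInstance, i'.comp i, f'',
    ι'.comp ι, hi'.comp hi, hf'', hι'.comp hι, ?_, ?_⟩
  · rw [← comp_assoc, hcomp', comp_assoc, hcomp, comp_assoc]
  have := hf''.isDomain
  rcases h with ⟨a, ha⟩ | ⟨a, b, z', e', G', hz, he', hG', hGu'⟩
  · left
    exact ⟨i' a₀ + i' (i c) * a, by simp [h', ha, hy]⟩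
  · right
    refine ⟨i' a₀ + i' (i c) * a, i' (i c) * b, z', i' e * e', G', ?_, ?_, ?_, hGu'⟩
    · rw [RingHom.comp_apply, hy, map_add, map_mul, hz, ← h', ← h', map_add, map_mul, map_mul]
      ring
    · refine mul_ne_zero (fun h0 => ?_) he'
      have h1 := h' e
      rw [h0, map_zero] at h1
      exact he (hf'.inj (hι'.injective (by rw [← h1, map_zero, map_zero])))
    · have h1 := congr_arg (fun p => (p.map i').comp (C a + C b * X)) hG
      simp only [F₂, Polynomial.map_mul, Polynomial.map_comp, Polynomial.map_map, map_C, mul_comp,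
        C_comp, hG', Polynomial.comp_assoc] at h1
      rw [C_mul (a := i' e), mul_assoc (C (i' e)), ← h1]
      congr 1
      simp
      ring

end RingHom

end

section

open Polynomial

theorem Polynomial.exists_eq_C_mul_isUnit_of_dvd {A B : Type*} [CommRing A] [IsDomain A]
    [ValuationRing A] [CommRing B] (f : A →+* B) {p F G : A[X]} {e : A} {z : B} (he : e ≠ 0)
    (hF0 : F ≠ 0) (hp : p ∣ F) (hF : F = C e * G) (hG : IsUnit (G.eval₂ f z)) :
    ∃ c P, c ≠ 0 ∧ p = C c * P ∧ IsUnit (P.eval₂ f z) := by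
  obtain ⟨q, rfl⟩ := hp
  obtain ⟨c, P, hc, rfl, hP⟩ := exists_eq_C_mul_isUnit_coeff p (left_ne_zero_of_mul hF0)
  obtain ⟨d, Q, hd, rfl, hQ⟩ := exists_eq_C_mul_isUnit_coeff q (right_ne_zero_of_mul hF0)
  refine ⟨c, P, hc, rfl, ?_⟩
  obtain ⟨m, hm⟩ := exists_isUnit_coeff_mul hP hQ
  have h1 : C (c * d) * (P * Q) = C e * G := by rw [← hF, C_mul]; ring
  have h2 := congr_arg (coeff · m) h1
  simp only [coeff_C_mul] at h2
  obtain ⟨t, ht⟩ : e ∣ c * d := by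
    rw [← hm.dvd_mul_right, h2]
    exact dvd_mul_right _ _
  have h3 : G = C t * (P * Q) := by
    refine mul_left_cancel₀ (C_ne_zero.mpr he) ?_
    rw [← h1, ht, C_mul, mul_assoc]
  rw [h3, eval₂_mul, eval₂_mul] at hG
  exact isUnit_of_mul_isUnit_left (isUnit_of_mul_isUnit_right hG)

namespace RingHom

/-- If rational functions `p j / r j` take values in `W` at `x` and become fractions with unit
denominators after an affine change of variable, then all their relations are visible in a smooth
algebra. -/
theorem exists_smooth_of_affine {A A' W Ω : Type v} [CommRing A] [CommRing A'] [IsDomain A]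
    [IsDomain A'] [CommRing W] [IsDomain W] [CommRing Ω] [IsDomain Ω] {f : A →+* W} {i : A →+* A'}
    {f' : A' →+* Ω} {ι : W →+* Ω} (hf' : f'.Immediate) (hi : Function.Injective i)
    (hcomp : f'.comp i = ι.comp f) {x : W}
    (hx : Function.Injective (eval₂RingHom f x)) {n : ℕ} {w : Fin n → W} {p r : Fin n → A[X]}
    (hr0 : ∀ j, r j ≠ 0) (hpr : ∀ j, w j * (r j).eval₂ f x = (p j).eval₂ f x) {a b : A'}
    (hb : b ≠ 0) {z : Ω} (hz : ι x = f' a + f' b * z)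
    (hp : ∀ j, ∃ e P, ((p j).map i).comp (C a + C b * X) = C e * P ∧ IsUnit (P.eval₂ f' z))
    (hr : ∀ j, ∃ e P, ((r j).map i).comp (C a + C b * X) = C e * P ∧ IsUnit (P.eval₂ f' z)) :
    ∃ (S : Type v) (_ : CommRing S) (_ : Algebra A' S) (h : S →+* Ω) (y : Fin n → S),
      Algebra.Smooth A' S ∧ h.comp (algebraMap A' S) = f' ∧ (∀ j, h (y j) = ι (w j)) ∧
      ∀ s : MvPolynomial (Fin n) A, s.eval₂ f w = 0 → s.eval₂ ((algebraMap A' S).comp i) y = 0 := by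
  choose e P he hP using hp
  choose c Q hc hQ using hr
  let φ : A[X] →+* A'[X] := eval₂RingHom (C.comp i) (C a + C b * X)
  have hφ (p : A[X]) : φ p = (p.map i).comp (C a + C b * X) := by
    rw [Polynomial.comp, eval₂_map]
    rfl
  have hφi : Function.Injective φ := by
    refine (injective_iff_map_eq_zero φ).mpr fun p hp => ?_
    rw [hφ, comp_eq_zero_iff] at hp
    rcases hp with hp | ⟨-, hp⟩
    · exact (Polynomial.map_eq_zero_iff hi).mp hp
    · have h := congr_arg (coeff · 1) hp
      simp [hb] at h
  have hφz (p : A[X]) : (φ p).eval₂ f' z = ι (p.eval₂ f x) := by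
    rw [hφ, eval₂_comp, eval₂_map, hcomp, hom_eval₂, hz]
    simp
  have hc0 (j) : c j ≠ 0 := by
    intro h
    have h1 := hc j
    rw [h, C_0, zero_mul, ← hφ] at h1
    exact hr0 j (hφi (by rw [h1, map_zero]))
  have hwe (j) : ι (w j) * (f' (c j) * (Q j).eval₂ f' z) = f' (e j) * (P j).eval₂ f' z := by
    have h := congr_arg ι (hpr j)
    rwa [map_mul, ← hφz, ← hφz, hφ, hφ, he, hc, eval₂_mul, eval₂_mul, eval₂_C, eval₂_C] at h
  have hdvd (j) : c j ∣ e j := by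
    refine hf'.dvd_of_dvd ?_
    rw [← (hP j).dvd_mul_right, ← hwe]
    exact (dvd_mul_right _ _).mul_left _
  choose t ht using hdvd
  let d := ∏ j, Q j
  have hd : IsUnit (eval₂RingHom f' z d) := by
    rw [map_prod, IsUnit.prod_iff]
    exact fun j _ => hQ j
  have hd0 : d ≠ 0 := by rintro h; rw [h, map_zero] at hd; exact not_isUnit_zero hd
  let S := Localization.Away d
  have hdS : Submonoid.powers d ≤ nonZeroDivisors A'[X] :=
    powers_le_nonZeroDivisors_of_noZeroDivisors hd0
  have : IsDomain S := IsLocalization.isDomain_localization hdS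
  let h : S →+* Ω := IsLocalization.Away.lift d hd
  have hh (q) : h (algebraMap A'[X] S q) = q.eval₂ f' z := by simp [h]
  have : Algebra.Smooth A' A'[X] := { finitePresentation := .polynomial A' A' }
  have : Algebra.Smooth A'[X] S :=
    { formallySmooth := Algebra.FormallySmooth.of_isLocalization (Submonoid.powers d)
      finitePresentation := IsLocalization.Away.finitePresentation d }
  have hQS (j) : IsUnit (algebraMap A'[X] S (Q j)) :=
    isUnit_of_dvd_unit (map_dvd _ (Finset.dvd_prod_of_mem Q (Finset.mem_univ j)))
      (IsLocalization.Away.algebraMap_isUnit d)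
  let y (j) : S := algebraMap A'[X] S (C (t j) * P j) * (hQS j).unit⁻¹
  have hy (j) : y j * algebraMap A'[X] S (Q j) = algebraMap A'[X] S (C (t j) * P j) := by
    rw [mul_assoc, IsUnit.val_inv_mul, mul_one]
  refine ⟨S, inferInstance, inferInstance, h, y, Algebra.Smooth.comp A' A'[X] S, ?_, fun j => ?_,
    fun s hs => ?_⟩
  · ext a
    rw [RingHom.comp_apply, IsScalarTower.algebraMap_apply A' A'[X] S, hh,
      Polynomial.algebraMap_apply,
      Algebra.algebraMap_self_apply, eval₂_C]
  · have h1 := congr_arg h (hy j)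
    rw [map_mul, hh, hh, eval₂_mul, eval₂_C] at h1
    refine (hQ j).mul_left_injective ?_
    change h (y j) * _ = _ * _
    refine mul_left_cancel₀ (a := f' (c j)) (fun h0 => hc0 j (hf'.inj (by simpa using h0))) ?_
    rw [h1, mul_left_comm _ (ι (w j)), hwe, ht, map_mul, mul_assoc]
  · let L := FractionRing S
    let K := FractionRing A[X]
    have hSL : Function.Injective (algebraMap S L) := IsFractionRing.injective S L
    let ψ₀ : A[X] →+* L := ((algebraMap S L).comp (algebraMap A'[X] S)).comp φ
    have hψ₀ : Function.Injective ψ₀ := (hSL.comp (IsLocalization.injective S hdS)).comp hφi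
    let ψ : K →+* L := IsFractionRing.lift hψ₀
    have hψ (p : A[X]) : ψ (algebraMap A[X] K p) = ψ₀ p := IsFractionRing.lift_algebraMap hψ₀ p
    have hWx : Function.Injective ((algebraMap W (FractionRing W)).comp (eval₂RingHom f x)) :=
      (IsFractionRing.injective W (FractionRing W)).comp hx
    let ψ' : K →+* FractionRing W := IsFractionRing.lift hWx
    have hψ' (p : A[X]) : ψ' (algebraMap A[X] K p) = algebraMap W _ (p.eval₂ f x) :=
      IsFractionRing.lift_algebraMap hWx p
    let k (j) : K := algebraMap A[X] K (p j) / algebraMap A[X] K (r j)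
    have hk' (j) : ψ' (k j) = algebraMap W _ (w j) := by
      rw [map_div₀, hψ', hψ', div_eq_iff, ← map_mul, hpr]
      exact fun h0 => hr0 j (hWx (by rw [map_zero]; exact h0))
    have hk (j) : ψ (k j) = algebraMap S L (y j) := by
      rw [map_div₀, hψ, hψ, div_eq_iff (fun h0 => hr0 j (hψ₀ (by rw [map_zero]; exact h0)))]
      simp only [ψ₀, RingHom.comp_apply]
      rw [← map_mul, hφ, hφ, he, hc, map_mul _ (C (c j)), mul_left_comm, hy, ← map_mul, ht, C_mul,
        mul_assoc]
    have hs0 : s.eval₂ ((algebraMap A[X] K).comp C) k = 0 := by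
      refine ψ'.injective ?_
      rw [map_zero, MvPolynomial.hom_eval₂]
      have h1 := congr_arg (algebraMap W (FractionRing W)) hs
      rw [MvPolynomial.hom_eval₂, map_zero] at h1
      rw [← h1]
      congr 1
      · ext a
        simp only [RingHom.comp_apply, hψ', eval₂_C]
      · exact funext hk'
    have h2 := congr_arg ψ hs0
    rw [map_zero, MvPolynomial.hom_eval₂] at h2
    refine hSL ?_
    rw [map_zero, MvPolynomial.hom_eval₂, ← h2]
    congr 1
    · ext a
      simp only [RingHom.comp_apply, hψ]
      simp [ψ₀, φ, IsScalarTower.algebraMap_apply A' A'[X] S]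
    · exact funext fun j => (hk j).symm

theorem Immediate.indSm_of_generated {A W : Type v} [CommRing A] [CommRing W] [IsDomain W]
    [ValuationRing W] {f : A →+* W} (hf : f.Immediate) (hQ : ∀ n : ℕ, n ≠ 0 → IsUnit (n : W))
    (x : W) (hx : ∀ w, w ∈ (eval₂RingHom f x).divClosure) : f.IndSm := by
  classical
  have := hf.isDomain
  have := hf.valuationRing
  refine .of_exists_exClosed fun n w R hw => ?_
  choose p r hr0 hpr using fun j => hx (w j)
  obtain ⟨F, hF0, hF⟩ : ∃ F : A[X], F ≠ 0 ∧ (F.eval₂ f x = 0 ∨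
      (Function.Injective (eval₂RingHom f x) ∧ ∀ j, r j ∣ F ∧ (p j ≠ 0 → p j ∣ F))) := by
    by_cases h : Function.Injective (eval₂RingHom f x)
    · refine ⟨∏ j, r j * if p j = 0 then 1 else p j, ?_, .inr ⟨h, fun j => ⟨?_, fun hj => ?_⟩⟩⟩
      · refine Finset.prod_ne_zero_iff.mpr fun j _ => mul_ne_zero ?_ ?_
        · exact fun h0 => hr0 j (by rw [h0, map_zero])
        · split_ifs with h0
          exacts [one_ne_zero, h0]
      · exact dvd_trans (dvd_mul_right _ _) (Finset.dvd_prod_of_mem _ (Finset.mem_univ j))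
      · refine dvd_trans ?_ (Finset.dvd_prod_of_mem _ (Finset.mem_univ j))
        rw [if_neg hj]
        exact dvd_mul_left _ _
    · rw [injective_iff_map_eq_zero] at h
      push Not at h
      obtain ⟨F, hF, hF0⟩ := h
      exact ⟨F, hF0, .inl hF⟩
  obtain ⟨e₀, F₀, he₀, rfl, hFu⟩ := exists_eq_C_mul_isUnit_coeff F hF0
  obtain ⟨μ, hμ⟩ := exists_isUnit_eval_iterate_derivative hQ (p := F₀.map f)
    (hFu.imp fun m hm => by rw [coeff_map]; exact hm.map f) x
  rw [iterate_derivative_map, eval_map] at hμ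
  obtain ⟨A', Ω, _, _, _, _, i, f', ι, hi, hf', hι, hcomp, hchart⟩ :=
    hf.exists_chart μ hQ x F₀ hμ
  have := hf'.isDomain
  have := hf'.valuationRing
  have hii : Function.Injective i := by
    refine .of_comp (f := f') ?_
    rw [← RingHom.coe_comp, hcomp]
    exact hι.injective.comp hf.inj
  obtain ⟨B, _, k, g, c, hk, hg, hc, hR⟩ : ∃ (B : Type v) (_ : CommRing B) (k : A →+* B)
      (g : B →+* Ω) (c : Fin n → B), k.IndSm ∧ g.comp k = ι.comp f ∧ (∀ j, g (c j) = ι (w j)) ∧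
      ∀ s ∈ R, s.eval₂ k c = 0 := by
    by_cases ha : ∃ a, f' a = ι x
    · obtain ⟨a, ha⟩ := ha
      have ha' (p : A[X]) : f' (p.eval₂ i a) = ι (p.eval₂ f x) := by
        rw [hom_eval₂, hcomp, hom_eval₂, ha]
      have hex (j) : ∃ c, f' c = ι (w j) := by
        refine hf'.exists_of_mul_eq ((r j).eval₂ i a) ((p j).eval₂ i a) _ (fun h0 => hr0 j ?_) ?_
        · refine hι.injective ?_
          rw [coe_eval₂RingHom, ← ha', h0, map_zero, map_zero]
        · rw [ha', ha', mul_comm, ← map_mul]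
          exact congr_arg ι (hpr j)
      choose c hc using hex
      refine ⟨A', inferInstance, i, f', c, hi, hcomp, hc, fun s hs => hf'.inj ?_⟩
      rw [MvPolynomial.hom_eval₂, hcomp, funext hc]
      have h := congr_arg ι (hw s hs)
      rw [MvPolynomial.hom_eval₂] at h
      rw [map_zero, h, map_zero]
    obtain ⟨a, b, z, e, G, hz, he, hG, hGu⟩ := hchart.resolve_left ha
    have hb : b ≠ 0 := by
      rintro rfl
      exact ha ⟨a, by simp [hz]⟩
    rcases hF with hF | ⟨hinj, hF⟩
    · have h := congr_arg (eval₂ f' z) hG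
      rw [eval₂_mul, eval₂_comp, eval₂_map, hcomp, eval₂_C] at h
      rw [eval₂_mul, eval₂_C, mul_eq_zero] at hF
      have h0 := hF.resolve_left fun h0 => he₀ (hf.inj (by rw [h0, map_zero]))
      have hz' : eval₂ f' z (C a + C b * X) = ι x := by simp [hz]
      rw [hz', ← hom_eval₂, h0, map_zero, eq_comm, mul_eq_zero] at h
      exact absurd (h.resolve_right hGu.ne_zero) fun h => he (hf'.inj (by rw [h, map_zero]))
    let φ : A[X] →+* A'[X] := (compRingHom (C a + C b * X)).comp (mapRingHom i)
    have hFG : φ (C e₀ * F₀) = C (i e₀ * e) * G := by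
      rw [map_mul]
      change _ * (F₀.map i).comp _ = _
      rw [hG, C_mul, mul_assoc]
      simp [φ]
    have hie : i e₀ * e ≠ 0 := mul_ne_zero (fun h => he₀ (hii (by rw [h, map_zero]))) he
    have hFG0 : φ (C e₀ * F₀) ≠ 0 := by
      rw [hFG]
      refine mul_ne_zero (C_ne_zero.mpr hie) ?_
      rintro rfl
      simp at hGu
    obtain ⟨S, _, _, h, y, hS, hh, hy, hrel⟩ := exists_smooth_of_affine hf' hii hcomp hinj
      (p := p) (r := r) (fun j h0 => hr0 j (by rw [h0, map_zero])) hpr hb hz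
      (fun j => by
        by_cases hj : p j = 0
        · exact ⟨0, 1, by simp [hj], by simp⟩
        · obtain ⟨c, P, -, h⟩ := exists_eq_C_mul_isUnit_of_dvd f' hie hFG0
            (map_dvd φ ((hF j).2 hj)) hFG hGu
          exact ⟨c, P, h⟩)
      (fun j => by
        obtain ⟨c, P, -, h⟩ := exists_eq_C_mul_isUnit_of_dvd f' hie hFG0
          (map_dvd φ (hF j).1) hFG hGu
        exact ⟨c, P, h⟩)
    refine ⟨S, inferInstance, (algebraMap A' S).comp i, h, y, (IndSm.of_smooth A' S).comp hi, ?_,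
      hy, fun s hs => hrel s (hw s hs)⟩
    rw [← comp_assoc, hh, hcomp]
  obtain ⟨S, _, _, h, y, hS, hh, hy, hrel⟩ := hk n c R hR
  refine ⟨Ω, inferInstance, ι, S, inferInstance, inferInstance, g.comp h, y, hι, hS, ?_,
    fun j => ?_, hrel⟩
  · rw [comp_assoc, hh, hg]
  · rw [RingHom.comp_apply, hy, hc]

end RingHom

end

section

open Polynomial

namespace RingHom

theorem Immediate.of_comp {A B D : Type*} [CommRing A] [CommRing B] [CommRing D] [IsDomain D]
    {f : A →+* B} {g : B →+* D} (h : (g.comp f).Immediate) (hg : g.Immediate) : f.Immediate where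
  inj := .of_comp (f := g) h.inj
  exists_of_mul_eq a b c ha hc := by
    obtain ⟨c', hc'⟩ := h.exists_of_mul_eq a b (g c) ha (by simp [← hc])
    exact ⟨c', hg.inj hc'⟩
  exists_associated w := by
    obtain ⟨a, ha⟩ := h.exists_associated (g w)
    have := hg.isDomain
    exact ⟨a, associated_of_dvd_dvd (hg.dvd_of_dvd ha.dvd) (hg.dvd_of_dvd ha.symm.dvd)⟩

theorem Immediate.exists_factor {A W : Type v} [CommRing A] [CommRing W] [IsDomain W]
    [ValuationRing W] {f : A →+* W} (hf : f.Immediate) (hQ : ∀ n : ℕ, n ≠ 0 → IsUnit (n : W))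
    (X : Finset W) : ∃ (B : Type v) (_ : CommRing B) (g : A →+* B) (h : B →+* W),
      g.IndSm ∧ h.Immediate ∧ h.comp g = f ∧ ∀ x ∈ X, x ∈ h.range := by
  classical
  induction X using Finset.induction_on with
  | empty => exact ⟨A, inferInstance, .id A, f, .id A, hf, rfl, by simp⟩
  | insert x X _ ih =>
    obtain ⟨B, _, g, h, hg, hh, hgf, hX⟩ := ih
    let k := eval₂RingHom h x
    let g' : B →+* k.divClosure := k.toDivClosure.comp C
    have hg' : k.divClosure.subtype.comp g' = h := by ext; simp [k, g']
    have hD : k.divClosure.subtype.Immediate := hh.divClosure k C (by ext; simp [k])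
    have := hD.valuationRing
    have hind : g'.IndSm := by
      refine (Immediate.of_comp (hg'.symm ▸ hh) hD).indSm_of_generated
        (fun n hn => hD.natCast_isUnit hQ n hn) (k.toDivClosure Polynomial.X) ?_
      have hk (p : B[X]) : (eval₂RingHom g' (k.toDivClosure Polynomial.X) p : W) = k p := by
        change k.divClosure.subtype (p.eval₂ _ _) = _
        rw [hom_eval₂, hg']
        simp [k]
      rintro ⟨w, p, r, hr, hw⟩
      exact ⟨p, r, fun h0 => hr (by rw [← hk, h0, ZeroMemClass.coe_zero]),
        Subtype.ext (by rw [MulMemClass.coe_mul, hk, hk, hw])⟩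
    refine ⟨k.divClosure, inferInstance, g'.comp g, k.divClosure.subtype, hind.comp hg, hD, ?_, ?_⟩
    · rw [← comp_assoc, hg', hgf]
    · intro y hy
      rcases Finset.mem_insert.mp hy with rfl | hy
      · exact ⟨k.toDivClosure Polynomial.X, by simp [k]⟩
      · obtain ⟨b, rfl⟩ := hX y hy
        exact ⟨g' b, by simp [g', k]⟩

theorem Immediate.indSm {A W : Type v} [CommRing A] [CommRing W] [IsDomain W]
    [ValuationRing W] {f : A →+* W} (hf : f.Immediate) (hQ : ∀ n : ℕ, n ≠ 0 → IsUnit (n : W)) :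
    f.IndSm := by
  classical
  intro n x R hR
  obtain ⟨B, _, g, h, hg, hh, hgf, hX⟩ := hf.exists_factor hQ (Finset.univ.image x)
  choose y hy using fun j => hX (x j) (by simp)
  obtain ⟨S, _, _, k, z, hS, hk, hz, hrel⟩ := hg n y R fun r hr => hh.inj (by
    rw [MvPolynomial.hom_eval₂, hgf, funext hy, map_zero, hR r hr])
  exact ⟨S, inferInstance, inferInstance, h.comp k, z, hS, by rw [comp_assoc, hk, hgf],
    fun j => by rw [RingHom.comp_apply, hz, hy], hrel⟩

end RingHom

end

section

open Matrix

/-- `y'` generates the same group as `y` through the change of basis `C`, and the exponents that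
are nonnegative at the infinitely positive coordinates of `y` stay so for `y'`. Here `P` is the
cone of a total preorder. -/
structure AddSubmonoid.Refines {G ι : Type*} [AddCommGroup G] [Fintype ι] [DecidableEq ι]
    (P : AddSubmonoid G) (y y' : ι → G) (C : Matrix ι ι ℤ) : Prop where
  mem : ∀ k, y' k ∈ P
  isUnit : IsUnit C
  eq_sum : ∀ i, y i = ∑ k, C i k • y' k
  nonneg : ∀ δ : ι → ℤ, (∀ k, -y k ∉ P → 0 ≤ δ k) → ∀ k, -y' k ∉ P → 0 ≤ (δ ᵥ* C) k

namespace AddSubmonoid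

theorem neg_notMem_of_neg_sub_notMem {G ι : Type*} [AddCommGroup G] [DecidableEq ι]
    {P : AddSubmonoid G} {y : ι → G} (hy : ∀ k, y k ∈ P) {i j k : ι}
    (hk : -Function.update y j (y j - y i) k ∉ P) : -y k ∉ P := by
  rcases eq_or_ne k j with rfl | hkj
  · intro h1
    refine hk ?_
    simpa [sub_eq_add_neg, add_comm] using add_mem h1 (hy i)
  · rwa [Function.update_of_ne hkj] at hk

variable {G ι : Type*} [AddCommGroup G] [Fintype ι] [DecidableEq ι] {P : AddSubmonoid G}
  {y y' y'' : ι → G} {C C' : Matrix ι ι ℤ}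

theorem Refines.refl (hy : ∀ k, y k ∈ P) : P.Refines y y 1 where
  mem := hy
  isUnit := isUnit_one
  eq_sum i := by simp [Matrix.one_apply]
  nonneg δ h k hk := by simpa using h k hk

theorem Refines.trans (h : P.Refines y y' C) (h' : P.Refines y' y'' C') :
    P.Refines y y'' (C * C') where
  mem := h'.mem
  isUnit := h.isUnit.mul h'.isUnit
  eq_sum i := by
    rw [h.eq_sum]
    simp only [h'.eq_sum, Finset.smul_sum, smul_smul, Matrix.mul_apply, Finset.sum_smul]
    exact Finset.sum_comm
  nonneg δ hδ k hk := by
    rw [← vecMul_vecMul]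
    exact h'.nonneg _ (h.nonneg δ hδ) k hk

theorem vecMul_transvection_apply (δ : ι → ℤ) (i j k : ι) :
    (δ ᵥ* transvection j i 1) k = δ k + if k = i then δ j else 0 := by
  rw [transvection, vecMul_add, vecMul_one, Pi.add_apply]
  simp [Matrix.single_apply, vecMul, dotProduct, ite_and, eq_comm]

theorem Refines.sub (hy : ∀ k, y k ∈ P) {i j : ι} (hij : i ≠ j) (h : y j - y i ∈ P) :
    P.Refines y (Function.update y j (y j - y i)) (transvection j i 1) where
  mem k := by
    rcases eq_or_ne k j with rfl | hk
    · simpa using h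
    · simpa [hk] using hy k
  isUnit := .of_mul_eq_one (transvection j i (-1)) (by
    rw [transvection_mul_transvection_same _ _ hij.symm, add_neg_cancel, transvection_zero])
  eq_sum k := by
    have h1 (l : ι) : transvection j i (1 : ℤ) k l =
        (if k = l then 1 else 0) + if j = k then if i = l then 1 else 0 else 0 := by
      simp [transvection, Matrix.one_apply, Matrix.single_apply, ite_and]
    simp only [h1, add_smul, Finset.sum_add_distrib, ite_smul, one_smul, zero_smul,
      Finset.sum_ite_eq, Finset.mem_univ, if_true]
    rcases eq_or_ne k j with rfl | hk
    · simp [hij]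
    · simp [hk, hk.symm]
  nonneg δ hδ k hk := by
    rw [vecMul_transvection_apply]
    have hj : -y j ∈ P → -y i ∈ P := fun h1 => by
      have h2 := add_mem h1 h
      rwa [show -y j + (y j - y i) = -y i by abel] at h2
    rcases eq_or_ne k j with rfl | hkj
    · rw [if_neg (Ne.symm hij), add_zero]
      refine hδ k fun h1 => hk ?_
      simpa [sub_eq_add_neg, add_comm] using add_mem h1 (hy i)
    rw [Function.update_of_ne hkj] at hk
    refine add_nonneg (hδ k hk) ?_
    split_ifs with h1
    · subst h1
      exact hδ j fun h2 => hk (hj h2)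
    · exact le_rfl

variable (P) in
/-- After some refinement the exponent vector `δ` has constant sign on the infinitely positive
coordinates. -/
def Decided (y : ι → G) (δ : ι → ℤ) : Prop :=
  ∃ y' C, P.Refines y y' C ∧
    ((∀ k, -y' k ∉ P → 0 ≤ (δ ᵥ* C) k) ∨ ∀ k, -y' k ∉ P → (δ ᵥ* C) k ≤ 0)

theorem Decided.of_neg {δ : ι → ℤ} (h : P.Decided y (-δ)) : P.Decided y δ := by
  obtain ⟨y', C, hC, h⟩ := h
  refine ⟨y', C, hC, h.symm.imp (fun h k hk => ?_) fun h k hk => ?_⟩ <;>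
  · have := h k hk
    rw [neg_vecMul, Pi.neg_apply] at this
    omega

theorem Decided.of_sub (hy : ∀ k, y k ∈ P) {i j : ι} (hij : i ≠ j) (h : y j - y i ∈ P) {δ : ι → ℤ}
    (hd : P.Decided (Function.update y j (y j - y i)) (δ ᵥ* transvection j i 1)) :
    P.Decided y δ := by
  obtain ⟨y', C, hC, h'⟩ := hd
  rw [vecMul_vecMul] at h'
  exact ⟨y', _, (Refines.sub hy hij h).trans hC, h'⟩

open Classical in
theorem Decided.of_max (htot : ∀ x : G, x ∈ P ∨ -x ∈ P) (M : ℤ) (c : ℕ)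
    (H : ∀ (y : ι → G) (δ : ι → ℤ), (∀ k, y k ∈ P) → (∀ k, -y k ∉ P → |δ k| ≤ M) →
      Finset.card {k | -y k ∉ P ∧ |δ k| = M} ≤ c → P.Decided y δ) (o : ℕ) :
    ∀ (y : ι → G) (δ : ι → ℤ) (i : ι), (∀ k, y k ∈ P) → (∀ k, -y k ∉ P → |δ k| ≤ M) →
      Finset.card {k | -y k ∉ P ∧ |δ k| = M} ≤ c + 1 → -y i ∉ P → δ i = M →
      Finset.card {k | -y k ∉ P ∧ δ k < 0} ≤ o → P.Decided y δ := by
  induction o with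
  | zero =>
    intro y δ i hy _ _ _ _ ho
    refine ⟨y, 1, .refl hy, .inl fun k hk => ?_⟩
    rw [Nat.le_zero, Finset.card_eq_zero, Finset.filter_eq_empty_iff] at ho
    simpa [hk] using ho (Finset.mem_univ k)
  | succ o ih =>
    intro y δ i hy hb hc hi hiM ho
    by_cases hj : ∃ j, -y j ∉ P ∧ δ j < 0
    swap
    · refine ⟨y, 1, .refl hy, .inl fun k hk => ?_⟩
      push Not at hj
      simpa using hj k hk
    obtain ⟨j, hj, hδj⟩ := hj
    have hjM := hb j hj
    have hM : 0 ≤ M := (abs_nonneg _).trans hjM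
    have hij : i ≠ j := by rintro rfl; omega
    rw [abs_of_neg hδj] at hjM
    by_cases h : y j - y i ∈ P
    · refine .of_sub hy hij h (H _ _ (Refines.sub hy hij h).mem (fun k hk => ?_) ?_)
      · have h1 := hb k (neg_notMem_of_neg_sub_notMem hy hk)
        rw [vecMul_transvection_apply]
        rw [abs_le] at h1 ⊢
        split_ifs with hki
        · subst hki; omega
        · omega
      · refine Nat.le_of_lt_succ (lt_of_lt_of_le (Finset.card_lt_card
          ((Finset.ssubset_iff_of_subset fun k hk => ?_).mpr ⟨i, ?_, ?_⟩)) hc)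
        · simp only [Finset.mem_filter, Finset.mem_univ, true_and,
          vecMul_transvection_apply] at hk ⊢
          refine ⟨neg_notMem_of_neg_sub_notMem hy hk.1, ?_⟩
          rcases eq_or_ne k i with rfl | hki
          · rw [hiM, abs_of_nonneg hM]
          · simpa [hki] using hk.2
        · simpa [hiM] using ⟨hi, hM⟩
        · simp only [Finset.mem_filter, Finset.mem_univ, true_and, vecMul_transvection_apply,
            if_true, hiM, not_and]
          rw [abs_of_nonneg (by omega)]
          omega
    · have h' : y i - y j ∈ P := by simpa [h] using htot (y j - y i)
      have hj' (k : ι) : |(δ ᵥ* transvection i j 1) k| = M → |δ k| = M := by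
        rw [vecMul_transvection_apply]
        split_ifs with hkj
        · subst hkj
          rw [hiM, abs_of_nonneg (by omega)]
          omega
        · rw [add_zero]
          exact id
      refine .of_sub hy hij.symm h' (ih _ _ i (Refines.sub hy hij.symm h').mem (fun k hk => ?_)
        ((Finset.card_le_card fun k hk => ?_).trans hc) ?_ ?_ ?_)
      · have h1 := hb k (neg_notMem_of_neg_sub_notMem hy hk)
        rw [vecMul_transvection_apply]
        rw [abs_le] at h1 ⊢
        split_ifs with hki
        · subst hki; omega
        · omega
      · simp only [Finset.mem_filter, Finset.mem_univ, true_and] at hk ⊢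
        exact ⟨neg_notMem_of_neg_sub_notMem hy hk.1, hj' k hk.2⟩
      · simpa using h
      · simpa [vecMul_transvection_apply, hij] using hiM
      · refine Nat.le_of_lt_succ (lt_of_lt_of_le (Finset.card_lt_card
          ((Finset.ssubset_iff_of_subset fun k hk => ?_).mpr ⟨j, ?_, ?_⟩)) ho)
        · simp only [Finset.mem_filter, Finset.mem_univ, true_and,
          vecMul_transvection_apply] at hk ⊢
          refine ⟨neg_notMem_of_neg_sub_notMem hy hk.1, ?_⟩
          have := hk.2
          split_ifs at this with hkj
          · exact hkj ▸ hδj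
          · omega
        · simp [hj, hδj]
        · simp only [Finset.mem_filter, Finset.mem_univ, true_and, vecMul_transvection_apply,
            if_true, hiM, not_and]
          omega

theorem decided (htot : ∀ x : G, x ∈ P ∨ -x ∈ P) (hy : ∀ k, y k ∈ P) (δ : ι → ℤ) :
    P.Decided y δ := by
  classical
  have key (M : ℕ) : ∀ (y : ι → G) (δ : ι → ℤ), (∀ k, y k ∈ P) → (∀ k, -y k ∉ P → |δ k| ≤ M) →
      P.Decided y δ := by
    induction M with
    | zero =>
      intro y δ hy hb
      refine ⟨y, 1, .refl hy, .inl fun k hk => ?_⟩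
      simpa using (abs_nonpos_iff.mp (hb k hk)).ge
    | succ M ih =>
      have h (c : ℕ) : ∀ (y : ι → G) (δ : ι → ℤ), (∀ k, y k ∈ P) →
          (∀ k, -y k ∉ P → |δ k| ≤ (M + 1 : ℕ)) →
          Finset.card {k | -y k ∉ P ∧ |δ k| = (M + 1 : ℕ)} ≤ c → P.Decided y δ := by
        induction c with
        | zero =>
          intro y δ hy hb hc
          refine ih y δ hy fun k hk => ?_
          rw [Nat.le_zero, Finset.card_eq_zero, Finset.filter_eq_empty_iff] at hc
          have h1 : |δ k| ≠ (M + 1 : ℕ) := by simpa [hk] using hc (Finset.mem_univ k)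
          have := hb k hk
          omega
        | succ c ihc =>
          intro y δ hy hb hc
          by_cases hi : ∃ i, -y i ∉ P ∧ |δ i| = (M + 1 : ℕ)
          · obtain ⟨i, hi, hiM⟩ := hi
            rcases abs_choice (δ i) with h | h
            · exact .of_max htot _ c ihc _ y δ i hy hb hc hi (h ▸ hiM) le_rfl
            · refine .of_neg (.of_max htot _ c ihc _ y (-δ) i hy ?_ ?_ hi ?_ le_rfl)
              · simpa using hb
              · simpa using hc
              · rw [Pi.neg_apply, ← h, hiM]
          · refine ih y δ hy fun k hk => ?_
            push Not at hi
            have := hb k hk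
            have := hi k hk
            omega
      exact fun y δ hy hb => h _ y δ hy hb le_rfl
  refine key (∑ k, (δ k).natAbs) y δ hy fun k _ => ?_
  rw [Int.abs_eq_natAbs]
  exact_mod_cast Finset.single_le_sum (f := fun k => (δ k).natAbs) (fun _ _ => Nat.zero_le _)
    (Finset.mem_univ k)

theorem zsmul_mem_of_nonneg {G : Type*} [AddCommGroup G] {P : AddSubmonoid G} {x : G} {n : ℤ}
    (hx : x ∈ P) (hn : -x ∉ P → 0 ≤ n) : n • x ∈ P := by
  rcases le_or_gt 0 n with h | h
  · lift n to ℕ using h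
    rw [natCast_zsmul]
    exact nsmul_mem hx n
  · obtain ⟨m, hm⟩ := Int.eq_ofNat_of_zero_le (a := -n) (by omega)
    rw [← neg_smul_neg, hm, natCast_zsmul]
    exact nsmul_mem (by_contra fun h1 => by have := hn h1; omega) m

theorem Refines.sum_smul (h : P.Refines y y' C) (δ : ι → ℤ) :
    ∑ i, δ i • y i = ∑ k, (δ ᵥ* C) k • y' k := by
  simp only [h.eq_sum, Finset.smul_sum, smul_smul, vecMul, dotProduct, Finset.sum_smul]
  exact Finset.sum_comm

theorem exists_refines (htot : ∀ x : G, x ∈ P ∨ -x ∈ P) (hy : ∀ k, y k ∈ P)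
    (X : Finset (ι → ℤ)) : ∃ y' C, P.Refines y y' C ∧ ∀ δ ∈ X, ∑ i, δ i • y i ∈ P →
      ∀ k, -y' k ∉ P → 0 ≤ (δ ᵥ* C) k := by
  classical
  induction X using Finset.induction_on with
  | empty => exact ⟨y, 1, .refl hy, by simp⟩
  | insert δ X _ ih =>
    obtain ⟨y₁, C₁, h₁, hX⟩ := ih
    obtain ⟨y₂, C₂, h₂, hδ⟩ := decided htot h₁.mem (δ ᵥ* C₁)
    refine ⟨y₂, C₁ * C₂, h₁.trans h₂, fun ε hε hεP => ?_⟩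
    rw [← vecMul_vecMul]
    rcases Finset.mem_insert.mp hε with rfl | hε
    · refine hδ.elim id fun h k hk => ?_
      by_contra! hlt
      refine hk ?_
      rw [h₁.sum_smul, h₂.sum_smul] at hεP
      set d := ε ᵥ* C₁ ᵥ* C₂
      have h3 : -y₂ k = ∑ l, d l • y₂ l + ∑ l, (-d l - if l = k then 1 else 0) • y₂ l := by
        simp only [sub_smul, neg_smul, ite_smul, one_smul, zero_smul, Finset.sum_sub_distrib,
          Finset.sum_neg_distrib, Finset.sum_ite_eq', Finset.mem_univ, if_true]
        abel
      rw [h3]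
      refine add_mem hεP (_root_.sum_mem fun l _ => zsmul_mem_of_nonneg (h₂.mem l) fun hl => ?_)
      split_ifs with hlk
      · subst hlk
        omega
      · have := h l hl
        omega
    · exact h₂.nonneg _ (hX ε hε hεP)

end AddSubmonoid

end

open Matrix in
theorem AddSubmonoid.Refines.forall_mem_iff {G ι : Type*} [AddCommGroup G] [Fintype ι]
    [DecidableEq ι] {P : AddSubmonoid G} {y y' : ι → G} {C : Matrix ι ι ℤ} (h : P.Refines y y' C)
    (H : AddSubgroup G) : (∀ i, y i ∈ H) ↔ ∀ k, y' k ∈ H := by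
  constructor
  · intro hy k
    obtain ⟨C', hC'⟩ := h.isUnit.exists_left_inv
    have h1 := h.sum_smul (C' k)
    have h2 : C' k ᵥ* C = Pi.single k 1 := by
      rw [← Matrix.mul_apply_eq_vecMul, hC']
      ext l
      simp [Matrix.one_apply, Pi.single_apply, eq_comm]
    simp only [h2, Pi.single_apply, ite_smul, one_smul, zero_smul, Finset.sum_ite_eq',
      Finset.mem_univ, if_true] at h1
    rw [← h1]
    exact _root_.sum_mem fun i _ => zsmul_mem (hy i) _
  · intro hy i
    rw [h.eq_sum]
    exact _root_.sum_mem fun k _ => zsmul_mem (hy k) _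

namespace RingHom

section

variable {V Ω : Type*} (L : Type*) [CommRing V] [CommRing Ω] [Field L] [Algebra Ω L]
  (f : V →+* Ω)

/-- The multiplicative group of ratios of elements of the range of `f`. -/
def ratios : Subgroup Lˣ where
  carrier := {u | ∃ a b, algebraMap Ω L (f a) ≠ 0 ∧ algebraMap Ω L (f b) ≠ 0 ∧
    u * algebraMap Ω L (f b) = algebraMap Ω L (f a)}
  mul_mem' := by
    rintro u u' ⟨a, b, ha, hb, h⟩ ⟨a', b', ha', hb', h'⟩
    refine ⟨a * a', b * b', by simp [ha, ha'], by simp [hb, hb'], ?_⟩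
    simp only [map_mul, ← h, ← h', Units.val_mul]
    ring
  one_mem' := ⟨1, 1, by simp, by simp, by simp⟩
  inv_mem' := by
    rintro u ⟨a, b, ha, hb, h⟩
    exact ⟨b, a, hb, ha, by rw [← h, Units.inv_mul_cancel_left]⟩

/-- The elements of the fraction field of `Ω` that become integral after multiplication by a
nonzero element of the range of `f`. -/
def integralUpTo : AddSubmonoid (Additive Lˣ) where
  carrier := {x | ∃ a w, algebraMap Ω L (f a) ≠ 0 ∧
    algebraMap Ω L w = x.toMul * algebraMap Ω L (f a)}
  add_mem' := by
    rintro x x' ⟨a, w, ha, h⟩ ⟨a', w', ha', h'⟩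
    refine ⟨a * a', w * w', by simp [ha, ha'], ?_⟩
    simp only [map_mul, h, h', toMul_add, Units.val_mul]
    ring
  zero_mem' := ⟨1, 1, by simp, by simp⟩

/-- The fractions `g A / g B` with `g B` a unit. -/
def unitFractions {R : Type*} [CommRing R] (g : R →+* Ω) : Subring L where
  carrier := {x | ∃ A B, IsUnit (g B) ∧ x * algebraMap Ω L (g B) = algebraMap Ω L (g A)}
  mul_mem' := by
    rintro x x' ⟨A, B, hB, h⟩ ⟨A', B', hB', h'⟩
    refine ⟨A * A', B * B', by rw [map_mul]; exact hB.mul hB', ?_⟩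
    simp only [map_mul, ← h, ← h']
    ring
  one_mem' := ⟨1, 1, by simp, by simp⟩
  add_mem' := by
    rintro x x' ⟨A, B, hB, h⟩ ⟨A', B', hB', h'⟩
    refine ⟨A * B' + A' * B, B * B', by rw [map_mul]; exact hB.mul hB', ?_⟩
    simp only [map_mul, map_add, ← h, ← h']
    ring
  zero_mem' := ⟨0, 1, by simp, by simp⟩
  neg_mem' := by
    rintro x ⟨A, B, hB, h⟩
    exact ⟨-A, B, hB, by simp [h]⟩

variable {L f}

theorem apply_mem_unitFractions {R : Type*} [CommRing R] (g : R →+* Ω) (r : R) :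
    algebraMap Ω L (g r) ∈ g.unitFractions L := ⟨r, 1, by simp, by simp⟩

theorem mem_unitFractions_of_mul_eq_one {R : Type*} [CommRing R] {g : R →+* Ω}
    (hinj : Function.Injective (algebraMap Ω L)) {w : Ω} {x : L} (hw : IsUnit w)
    (h : algebraMap Ω L w ∈ g.unitFractions L) (hx : algebraMap Ω L w * x = 1) :
    x ∈ g.unitFractions L := by
  obtain ⟨A, B, hB, h⟩ := h
  rw [← map_mul] at h
  refine ⟨B, A, hinj h ▸ hw.mul hB, ?_⟩
  rw [← h, map_mul, ← mul_assoc, mul_comm x, hx, one_mul]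

theorem exists_common_denominator {T : Finset Lˣ}
    (κ : Lˣ → Lˣ) (hκ : ∀ u ∈ T, κ u ∈ f.ratios L) :
    ∃ d, algebraMap Ω L (f d) ≠ 0 ∧ ∀ u ∈ T, ∃ a,
      κ u * algebraMap Ω L (f d) = algebraMap Ω L (f a) := by
  classical
  choose! a b ha hb h using hκ
  refine ⟨∏ u ∈ T, b u, ?_, fun u hu => ⟨a u * ∏ t ∈ T.erase u, b t, ?_⟩⟩
  · simp only [map_prod]
    exact Finset.prod_ne_zero_iff.mpr hb
  · rw [← Finset.mul_prod_erase T b hu]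
    simp only [map_mul]
    rw [← mul_assoc, h u hu]

theorem zpow_mem_unitFractions {R : Type*} [CommRing R] {g : R →+* Ω}
    (hinj : Function.Injective (algebraMap Ω L)) {w : Ω}
    (h : algebraMap Ω L w ∈ g.unitFractions L)
    {n : ℤ} (hn : IsUnit w ∨ 0 ≤ n) :
    algebraMap Ω L w ^ n ∈ g.unitFractions L := by
  rcases le_or_gt 0 n with h0 | h0
  · lift n to ℕ using h0
    rw [zpow_natCast]
    exact pow_mem h n
  · have hw := hn.resolve_right (by omega)
    obtain ⟨m, hm⟩ := Int.eq_ofNat_of_zero_le (a := -n) (by omega)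
    rw [← neg_neg n, hm, zpow_neg, ← inv_zpow, zpow_natCast]
    refine pow_mem (mem_unitFractions_of_mul_eq_one hinj hw h ?_) m
    exact mul_inv_cancel₀ (hw.map _).ne_zero

variable [IsDomain Ω] [IsFractionRing Ω L]

/-- Dichotomy: every nonzero element is associated to an element of the range of `f` or divisible
by all its nonzero elements. -/
def Dichotomy (f : V →+* Ω) : Prop :=
  ∀ w, w ≠ 0 → (∃ a, Associated (f a) w) ∨ ∀ a, f a ≠ 0 → f a ∣ w

theorem exists_isUnit_of_neg_mem (hf : Dichotomy f) {x : Additive Lˣ} (hx : x ∈ f.integralUpTo L)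
    (hx' : -x ∈ f.integralUpTo L) :
    ∃ κ ∈ f.ratios L, ∃ z : Ω, IsUnit z ∧ (x.toMul : L) = κ * algebraMap Ω L z := by
  obtain ⟨a, w, ha, hw⟩ := hx
  obtain ⟨b, w', hb, hw'⟩ := hx'
  have hww : w * w' = f (a * b) := by
    apply IsFractionRing.injective Ω L
    rw [map_mul, hw, hw', map_mul, map_mul, toMul_neg]
    rw [mul_mul_mul_comm, Units.mul_inv, one_mul]
  have h0 : w ≠ 0 := by
    rintro rfl
    simp [ha] at hw
  have hab : f (a * b) ≠ 0 := by
    rw [map_mul]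
    exact mul_ne_zero (fun h => ha (by rw [h, map_zero])) fun h => hb (by rw [h, map_zero])
  have hc : ∃ c, Associated (f c) w := by
    refine (hf w h0).elim (fun h => h) fun h => ⟨a * b, ?_⟩
    exact associated_of_dvd_dvd (h _ hab) (hww ▸ dvd_mul_right _ _)
  obtain ⟨c, z, hz⟩ := hc
  have hfc : algebraMap Ω L (f c) ≠ 0 := by
    intro h
    rw [← hz, map_mul, h, zero_mul] at hw
    simp [ha] at hw
  refine ⟨Units.mk0 _ hfc / Units.mk0 _ ha, ⟨c, a, hfc, ha, by simp [ha]⟩, z, z.isUnit, ?_⟩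
  rw [← hz, map_mul] at hw
  simp only [Units.val_div_eq_div_val, Units.val_mk0]
  field_simp
  exact hw.symm

variable [ValuationRing Ω]

theorem mem_or_neg_mem_integralUpTo (x : Additive Lˣ) :
    x ∈ f.integralUpTo L ∨ -x ∈ f.integralUpTo L := by
  refine (ValuationRing.isInteger_or_isInteger Ω (x.toMul : L)).imp ?_ ?_
  · rintro ⟨w, hw⟩
    exact ⟨1, w, by simp, by simpa using hw⟩
  · rintro ⟨w, hw⟩
    exact ⟨1, w, by simp, by simpa using hw⟩

theorem exists_of_neg_notMem {x : Additive Lˣ} (hx : -x ∉ f.integralUpTo L) {κ : Lˣ}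
    (hκ : κ ∈ f.ratios L) : ∃ z : Ω, (x.toMul : L) = κ * algebraMap Ω L z := by
  obtain ⟨a, b, ha, hb, h⟩ := hκ
  rcases ValuationRing.isInteger_or_isInteger Ω ((x.toMul : L) / algebraMap Ω L (f a)) with
    ⟨w, hw⟩ | ⟨w, hw⟩
  · refine ⟨w * f b, ?_⟩
    rw [map_mul, hw, mul_left_comm, h]
    field_simp
  · refine absurd ⟨a, w, ha, ?_⟩ hx
    rw [hw, toMul_neg, Units.val_inv_eq_inv_val]
    field_simp

open Classical in
theorem exists_coordinates (hf : Dichotomy f) (hdvd : ∀ a b, f a ∣ f b → a ∣ b)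
    {ι : Type*} [Fintype ι] (s : ι → Lˣ) (hs : ∀ i, ∃ w, algebraMap Ω L w = s i) (T : Finset Lˣ)
    (hT : ∀ u ∈ T, (∃ w, algebraMap Ω L w = u) ∧
      ∃ κ ∈ f.ratios L, ∃ δ : ι → ℤ, u = κ * ∏ i, s i ^ δ i) :
    ∃ (z : ι → Ω) (z' : ι → Lˣ), (∀ k, algebraMap Ω L (z k) = z' k) ∧
      (∀ H : Subgroup Lˣ, f.ratios L ≤ H → ((∀ i, s i ∈ H) ↔ ∀ k, z' k ∈ H)) ∧
      ∀ u ∈ T, (u : L) ∈ (MvPolynomial.eval₂Hom f z).unitFractions L := by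
  choose hTw κ hκ δ hδ using hT
  choose! w hw using hTw
  choose! κ hκ δ hδ using fun u hu => (⟨κ u hu, hκ u hu, δ u hu, hδ u hu⟩ :
    ∃ κ ∈ f.ratios L, ∃ δ : ι → ℤ, u = κ * ∏ i, s i ^ δ i)
  let P := f.integralUpTo L
  obtain ⟨y', C, hC, hX⟩ := P.exists_refines (y := fun i => Additive.ofMul (s i))
    mem_or_neg_mem_integralUpTo
    (fun k => (hs k).elim fun w hw => ⟨1, w, by simp, by simpa using hw⟩) (T.image δ)
  let e : Lˣ → ι → ℤ := fun u => Matrix.vecMul (δ u) C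
  have hprod : ∀ u, ∏ i, s i ^ δ u i = ∏ k, (y' k).toMul ^ e u k := fun u => by
    simpa using congrArg Additive.toMul (hC.sum_smul (δ u))
  have he : ∀ u ∈ T, ∀ k, -y' k ∉ P → 0 ≤ e u k := by
    intro u hu
    refine hX _ (Finset.mem_image_of_mem _ hu) ?_
    obtain ⟨a, b, ha, hb, h⟩ := hκ u hu
    refine ⟨a, w u * f b, ha, ?_⟩
    rw [map_mul, hw u hu, ← h]
    conv_lhs => rw [hδ u hu]
    simp
    ring
  have hc : ∀ k, ∃ c ∈ f.ratios L, -y' k ∈ P →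
      ∃ z : Ω, IsUnit z ∧ ((y' k).toMul : L) = c * algebraMap Ω L z := by
    intro k
    by_cases hk : -y' k ∈ P
    · obtain ⟨c, hc, h⟩ := exists_isUnit_of_neg_mem hf (hC.mem k) hk
      exact ⟨c, hc, fun _ => h⟩
    · exact ⟨1, one_mem _, fun h => absurd h hk⟩
  choose c hc hcz using hc
  let κ' : Lˣ → Lˣ := fun u => κ u * ∏ k, if -y' k ∈ P then c k ^ e u k else 1
  have hκ' : ∀ u ∈ T, κ' u ∈ f.ratios L := fun u hu => by
    refine mul_mem (hκ u hu) (prod_mem fun k _ => ?_)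
    split_ifs
    exacts [zpow_mem (hc k) _, one_mem _]
  obtain ⟨d, hd, hda⟩ := exists_common_denominator κ' hκ'
  let D : Lˣ := Units.mk0 _ hd
  let c' : ι → Lˣ := fun k => if -y' k ∈ P then c k else D
  have hD : D ∈ f.ratios L := ⟨d, 1, hd, by simp, by simp [D]⟩
  have hc' : ∀ k, c' k ∈ f.ratios L := fun k => by
    dsimp only [c']
    split_ifs
    exacts [hc k, hD]
  have hz : ∀ k, ∃ z : Ω, ((y' k).toMul : L) = c' k * algebraMap Ω L z ∧
      (-y' k ∈ P → IsUnit z) := by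
    intro k
    by_cases hk : -y' k ∈ P
    · obtain ⟨z, hz, h⟩ := hcz k hk
      exact ⟨z, by simpa only [c', if_pos hk] using h, fun _ => hz⟩
    · obtain ⟨z, h⟩ := exists_of_neg_notMem hk (hc' k)
      exact ⟨z, h, fun h => absurd h hk⟩
  choose z hz hzu using hz
  have hz' : ∀ k, algebraMap Ω L (z k) = ((c' k)⁻¹ * (y' k).toMul : Lˣ) := fun k => by
    rw [Units.val_mul, hz, Units.inv_mul_cancel_left]
  refine ⟨z, fun k => (c' k)⁻¹ * (y' k).toMul, hz', fun H hH => ?_, fun u hu => ?_⟩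
  · refine (hC.forall_mem_iff H.toAddSubgroup).trans (forall_congr' fun k => ?_)
    exact (H.mul_mem_cancel_left (inv_mem (hH (hc' k)))).symm
  let U := (MvPolynomial.eval₂Hom f z).unitFractions L
  have hzU : ∏ k, algebraMap Ω L (z k) ^ e u k ∈ U := by
    refine prod_mem fun k _ => zpow_mem_unitFractions (IsFractionRing.injective Ω L) ?_ ?_
    · simpa using apply_mem_unitFractions (L := L) (MvPolynomial.eval₂Hom f z) (.X k)
    · by_cases hk : -y' k ∈ P
      exacts [.inl (hzu k hk), .inr (he u hu k hk)]
  have huz : (u : L) = (κ' u * ∏ k, if -y' k ∈ P then 1 else D ^ e u k : Lˣ) *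
      ∏ k, algebraMap Ω L (z k) ^ e u k := by
    conv_lhs => rw [hδ u hu, hprod u]
    simp only [κ', Units.val_mul, Units.coe_prod, mul_assoc]
    rw [← Finset.prod_mul_distrib, ← Finset.prod_mul_distrib]
    congr 1
    refine Finset.prod_congr rfl fun k _ => ?_
    rw [Units.val_zpow_eq_zpow_val, hz, mul_zpow]
    dsimp only [c']
    split_ifs <;> simp
  rw [huz]
  refine mul_mem ?_ hzU
  suffices h : ∃ a, ((κ' u * ∏ k, if -y' k ∈ P then 1 else D ^ e u k : Lˣ) : L) =
      algebraMap Ω L (f a) by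
    obtain ⟨a, ha⟩ := h
    rw [ha]
    simpa using apply_mem_unitFractions (L := L) (MvPolynomial.eval₂Hom f z) (.C a)
  by_cases h0 : ∀ k, -y' k ∉ P → e u k = 0
  · have h1 : (∏ k, if -y' k ∈ P then 1 else D ^ e u k) = 1 := Finset.prod_eq_one fun k _ => by
      split_ifs with hk
      · rfl
      · rw [h0 k hk, zpow_zero]
    rw [h1, mul_one] at huz ⊢
    have h2 : ∃ x : Ωˣ, ∏ k, algebraMap Ω L (z k) ^ e u k = algebraMap Ω L x := by
      refine Finset.prod_induction _ (fun y => ∃ x : Ωˣ, y = algebraMap Ω L x) ?_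
        ⟨1, by simp⟩ fun k _ => ?_
      · rintro _ _ ⟨x, rfl⟩ ⟨x', rfl⟩
        exact ⟨x * x', by simp⟩
      · by_cases hk : -y' k ∈ P
        · obtain ⟨x, hx⟩ := hzu k hk
          refine ⟨x ^ e u k, ?_⟩
          rw [← hx]
          have h := congrArg Units.val (map_zpow (Units.map (algebraMap Ω L : Ω →* L)) x (e u k))
          rw [Units.val_zpow_eq_zpow_val] at h
          exact h.symm
        · exact ⟨1, by simp [h0 k hk]⟩
    obtain ⟨x, hx⟩ := h2
    obtain ⟨a, b, ha, hb, h⟩ := hκ' u hu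
    obtain ⟨a', rfl⟩ : b ∣ a := hdvd _ _ ⟨w u * ↑x⁻¹, IsFractionRing.injective Ω L (by
      rw [← h, map_mul, map_mul, hw u hu, huz, hx, mul_assoc, ← map_mul, Units.mul_inv, map_one,
        mul_one, mul_comm])⟩
    refine ⟨a', mul_right_cancel₀ hb ?_⟩
    rw [h, map_mul, map_mul, mul_comm]
  · push Not at h0
    obtain ⟨k, hk, hk0⟩ := h0
    have hek := he u hu k hk
    obtain ⟨a, ha⟩ := hda u hu
    refine ⟨a * d ^ (e u k - 1).toNat * ∏ l ∈ Finset.univ.erase k,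
      if -y' l ∈ P then 1 else d ^ (e u l).toNat, ?_⟩
    rw [← Finset.mul_prod_erase _ _ (Finset.mem_univ k), if_neg hk]
    simp only [map_mul, map_prod, map_pow, ← ha, Units.val_mul, Units.coe_prod]
    rw [mul_assoc, mul_assoc]
    congr 1
    rw [← mul_assoc, ← pow_succ']
    congr 1
    · rw [Units.val_zpow_eq_zpow_val, ← zpow_natCast]
      congr 1
      push_cast
      omega
    · refine Finset.prod_congr rfl fun l _ => ?_
      split_ifs with hl
      · simp
      · have := he u hu l hl
        rw [Units.val_zpow_eq_zpow_val, map_pow, map_pow, ← zpow_natCast, Int.toNat_of_nonneg this]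
        rfl

end
end RingHom

theorem AlgebraicIndependent.of_forall_isAlgebraic {R L ι : Type*} [CommRing R] [IsDomain R]
    [Field L] [Algebra R L] [FaithfulSMul R L] [Finite ι] {s z : ι → L}
    (hs : AlgebraicIndependent R s)
    (h : ∀ i, IsAlgebraic (Algebra.adjoin R (Set.range z)) (s i)) : AlgebraicIndependent R z := by
  let M := AlgebraicIndependent.matroid R L
  have hsub : Set.range s ⊆ M.closure (Set.range z) := by
    rw [AlgebraicIndependent.matroid_closure_eq]
    rintro _ ⟨i, rfl⟩
    exact h i
  have h1 : (Set.range s).encard ≤ M.eRk (Set.range z) := by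
    have hI : M.Indep (Set.range s) := matroid_indep_iff.mpr hs.to_subtype_range
    rw [← M.eRk_closure_eq]
    exact hI.encard_le_eRk_of_subset hsub
  have h2 : (Set.range z).encard ≤ (Set.univ : Set ι).encard := by
    rw [← Set.image_univ]
    exact Set.encard_image_le _ _
  have h0 : (Set.univ : Set ι).encard ≤ (Set.range s).encard := by
    rw [Set.encard_univ]
    exact hs.injective.encard_range
  have h3 := M.eRk_le_encard (Set.range z)
  refine .of_subtype_range ?_ (matroid_indep_iff.mp
    ((M.indep_iff_eRk_eq_encard_of_finite (Set.finite_range z)).mpr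
      (le_antisymm h3 (h2.trans (h0.trans h1)))))
  rw [← Set.injOn_univ]
  refine Set.finite_univ.injOn_of_encard_image_eq ?_
  rw [Set.image_univ]
  exact le_antisymm h2 (h0.trans (h1.trans h3))

namespace RingHom

section

variable {V Ω L ι : Type*} [CommRing V] [CommRing Ω] [Field L] [Algebra Ω L] {f : V →+* Ω}

theorem eval₂Hom_injective_of_forall_mem [IsDomain V] [IsDomain Ω] [FaithfulSMul Ω L]
    [_root_.Finite ι]
    {s z : ι → Ω} {s' z' : ι → Lˣ} (hs' : ∀ i, algebraMap Ω L (s i) = s' i)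
    (hz' : ∀ i, algebraMap Ω L (z i) = z' i)
    (h : ∀ H : Subgroup Lˣ, f.ratios L ≤ H → (∀ k, z' k ∈ H) → ∀ i, s' i ∈ H)
    (hs : Function.Injective (MvPolynomial.eval₂Hom f s)) :
    Function.Injective (MvPolynomial.eval₂Hom f z) := by
  let _ : Algebra V L := ((algebraMap Ω L).comp f).toAlgebra
  have hinj : Function.Injective (algebraMap Ω L) := FaithfulSMul.algebraMap_injective Ω L
  have hf : Function.Injective f := fun a b hab => MvPolynomial.C_injective ι V (hs (by simpa))
  have : FaithfulSMul V L := (faithfulSMul_iff_algebraMap_injective V L).mpr (hinj.comp hf)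
  have hae : ∀ t : ι → Ω, ∀ p, MvPolynomial.aeval (fun i => algebraMap Ω L (t i)) p =
      algebraMap Ω L (MvPolynomial.eval₂Hom f t p) := fun t p => by
    rw [MvPolynomial.aeval_def, MvPolynomial.coe_eval₂Hom, MvPolynomial.hom_eval₂]
    rfl
  have hs1 : AlgebraicIndependent V fun i => algebraMap Ω L (s i) := fun p p' hp =>
    hs (hinj (by rwa [hae, hae] at hp))
  have hz1 : AlgebraicIndependent V fun i => algebraMap Ω L (z i) := by
    refine hs1.of_forall_isAlgebraic fun i => ?_
    let A := Algebra.adjoin V (Set.range fun i => algebraMap Ω L (z i))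
    have hA : ∀ x ∈ A, IsAlgebraic A x := fun x hx => isAlgebraic_algebraMap (⟨x, hx⟩ : A)
    let H : Subgroup Lˣ :=
      { carrier := {u | IsAlgebraic A (u : L)}
        mul_mem' := fun h h' => IsAlgebraic.mul h h'
        one_mem' := isAlgebraic_one
        inv_mem' := fun {u} h => by
          rw [Set.mem_ofPred_eq, Units.val_inv_eq_inv_val]
          exact IsAlgebraic.inv h }
    rw [hs']
    refine h H ?_ (fun k => ?_) i
    · rintro u ⟨a, b, ha, hb, hu⟩
      have : (u : L) = algebraMap V L a * (algebraMap V L b)⁻¹ := by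
        rw [← div_eq_mul_inv]
        exact (eq_div_iff hb).mpr hu
      change IsAlgebraic A (u : L)
      rw [this]
      exact (hA _ (A.algebraMap_mem a)).mul (hA _ (A.algebraMap_mem b)).inv
    · change IsAlgebraic A (z' k : L)
      rw [← hz']
      exact hA _ (Algebra.subset_adjoin ⟨k, rfl⟩)
  intro p p' hp
  apply hz1
  rw [hae, hae, hp]

theorem mem_of_forall_mem [FaithfulSMul Ω L] {D : Subring Ω}
    (hD : ∀ r ∈ D, r ≠ 0 → ∀ w, w * r ∈ D → w ∈ D) (hfD : ∀ a, f a ∈ D)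
    {s z : ι → Ω} {s' z' : ι → Lˣ} (hs' : ∀ i, algebraMap Ω L (s i) = s' i)
    (hz' : ∀ i, algebraMap Ω L (z i) = z' i)
    (h : ∀ H : Subgroup Lˣ, f.ratios L ≤ H → (∀ k, s' k ∈ H) → ∀ i, z' i ∈ H)
    (hsD : ∀ i, s i ∈ D) (i : ι) : z i ∈ D := by
  obtain ⟨a, b, -, hb, hi⟩ := h (D.subtype.ratios L)
    (fun u ⟨a, b, ha, hb, hu⟩ => ⟨⟨f a, hfD a⟩, ⟨f b, hfD b⟩, ha, hb, hu⟩)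
    (fun k => ⟨⟨s k, hsD k⟩, 1, by simp [hs'], by simp, by simp [hs']⟩) i
  refine hD b b.2 (fun h => hb (by simp [h])) _ ?_
  have : z i * b = a := FaithfulSMul.algebraMap_injective Ω L (by rw [map_mul, hz']; exact hi)
  rw [this]
  exact a.2

end

end RingHom

namespace RingHom

section

variable {V Ω : Type*} [CommRing V] [CommRing Ω] [IsDomain Ω] [ValuationRing Ω] {f : V →+* Ω}

theorem exists_associated_term {ι : Type*} [Fintype ι] {s : ι → Ω}
    {p : MvPolynomial ι V} (hp : p ≠ 0)
    (hM : ∀ m, p.eval₂ f s ∣ f (p.coeff m) * ∏ i, s i ^ m i) :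
    ∃ m ∈ p.support, (∀ j ∈ p.support,
      f (p.coeff m) * ∏ i, s i ^ m i ∣ f (p.coeff j) * ∏ i, s i ^ j i) ∧
      Associated (f (p.coeff m) * ∏ i, s i ^ m i) (p.eval₂ f s) := by
  obtain ⟨m, hm, h⟩ := ValuationRing.exists_forall_dvd p.support
    (Finset.nonempty_iff_ne_empty.mpr (by simpa using hp))
    fun j => f (p.coeff j) * ∏ i, s i ^ j i
  refine ⟨m, hm, h, associated_of_dvd_dvd ?_ (hM m)⟩
  rw [MvPolynomial.eval₂_eq']
  exact Finset.dvd_sum h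

open Classical in
theorem exists_chart [IsDomain V] {ι : Type*} [Fintype ι] (hf : Dichotomy f)
    (hdvd : ∀ a b, f a ∣ f b → a ∣ b) {s : ι → Ω} (hs0 : ∀ i, s i ≠ 0)
    (hM : ∀ (p : MvPolynomial ι V) m, p.eval₂ f s ∣ f (p.coeff m) * ∏ i, s i ^ m i)
    {D : Subring Ω} (hD : ∀ r ∈ D, r ≠ 0 → ∀ w, w * r ∈ D → w ∈ D) (hfD : ∀ a, f a ∈ D)
    (hsD : ∀ i, s i ∈ D) (X : Finset (MvPolynomial ι V)) :
    ∃ z : ι → Ω, Function.Injective (MvPolynomial.eval₂Hom f z) ∧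
      (∀ p, MvPolynomial.eval₂Hom f z p ∈ D) ∧ ∀ p ∈ X, ∀ r ∈ X, ∀ b,
        r.eval₂ f s ≠ 0 → b * r.eval₂ f s = p.eval₂ f s → ∃ A B,
          IsUnit (MvPolynomial.eval₂Hom f z B) ∧
          b * MvPolynomial.eval₂Hom f z B = MvPolynomial.eval₂Hom f z A := by
  let L := FractionRing Ω
  have hinj : Function.Injective (algebraMap Ω L) := IsFractionRing.injective Ω L
  have hf0 : ∀ a, f a = 0 → a = 0 := fun a ha =>
    zero_dvd_iff.mp (hdvd 0 a (by rw [ha]; exact dvd_zero _))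
  have hL0 : ∀ w, w ≠ 0 → algebraMap Ω L w ≠ 0 := fun w hw h =>
    hw (hinj (by rw [h, map_zero]))
  let t : MvPolynomial ι V → (ι →₀ ℕ) → Ω := fun p m => f (p.coeff m) * ∏ i, s i ^ m i
  have ht0 : ∀ p, ∀ m ∈ p.support, t p m ≠ 0 := fun p m hm =>
    mul_ne_zero (fun h => MvPolynomial.mem_support_iff.mp hm (hf0 _ h))
      (Finset.prod_ne_zero_iff.mpr fun i _ => pow_ne_zero _ (hs0 i))
  have hs : Function.Injective (MvPolynomial.eval₂Hom f s) := by
    rw [injective_iff_map_eq_zero]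
    intro p hp
    by_contra h
    obtain ⟨m, hm⟩ := Finset.nonempty_iff_ne_empty.mpr (mt MvPolynomial.support_eq_empty.mp h)
    refine ht0 p m hm (zero_dvd_iff.mp ?_)
    rw [← hp]
    exact hM p m
  let S : ι → Lˣ := fun i => Units.mk0 _ (hL0 _ (hs0 i))
  let κ : V → Lˣ := fun a => if h : algebraMap Ω L (f a) = 0 then 1 else Units.mk0 _ h
  have hκ : ∀ a, κ a ∈ f.ratios L := fun a => by
    by_cases h : algebraMap Ω L (f a) = 0
    · simp only [κ, dif_pos h]
      exact one_mem _
    · simp only [κ, dif_neg h]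
      exact ⟨a, 1, h, by simp, by simp⟩
  let u : MvPolynomial ι V → (ι →₀ ℕ) → Lˣ := fun p m => κ (p.coeff m) * ∏ i, S i ^ m i
  have hu : ∀ p, ∀ m ∈ p.support, algebraMap Ω L (t p m) = u p m := fun p m hm => by
    have : algebraMap Ω L (f (p.coeff m)) ≠ 0 :=
      hL0 _ fun h => MvPolynomial.mem_support_iff.mp hm (hf0 _ h)
    have hκp : (κ (p.coeff m) : L) = algebraMap Ω L (f (p.coeff m)) := by
      simp only [κ, dif_neg this, Units.val_mk0]
    simp [u, t, S, hκp]
  let Y := X.biUnion fun p => p.support.image (u p)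
  let T : Finset Lˣ :=
    ((Y ×ˢ Y).image fun x => x.1 / x.2).filter fun x => ∃ w, algebraMap Ω L w = x
  obtain ⟨z, z', hz', hz, hT⟩ := exists_coordinates hf hdvd S (fun i => ⟨s i, rfl⟩) T (by
    intro x hx
    obtain ⟨hx, hw⟩ := Finset.mem_filter.mp hx
    refine ⟨hw, ?_⟩
    obtain ⟨⟨x₁, x₂⟩, hx12, rfl⟩ := Finset.mem_image.mp hx
    simp only [Finset.mem_product, Y, Finset.mem_biUnion, Finset.mem_image] at hx12
    obtain ⟨⟨p, -, m, -, rfl⟩, ⟨r, -, j, -, rfl⟩⟩ := hx12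
    refine ⟨_, div_mem (hκ (p.coeff m)) (hκ (r.coeff j)), fun i => m i - j i, ?_⟩
    simp only [u, zpow_sub, zpow_natCast, Finset.prod_mul_distrib, Finset.prod_inv_distrib]
    rw [mul_div_mul_comm, ← div_eq_mul_inv])
  have hzi := eval₂Hom_injective_of_forall_mem (s' := S) (fun i => rfl) hz'
    (fun H hH => (hz H hH).mpr) hs
  have hzD := mem_of_forall_mem hD hfD (s' := S) (fun i => rfl) hz' (fun H hH => (hz H hH).mp) hsD
  refine ⟨z, hzi, fun p => ?_, fun p hp r hr b hr0 hb => ?_⟩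
  · rw [MvPolynomial.coe_eval₂Hom, MvPolynomial.eval₂_eq']
    exact sum_mem fun m _ => mul_mem (hfD _) (prod_mem fun i _ => pow_mem (hzD i) _)
  let U := (MvPolynomial.eval₂Hom f z).unitFractions L
  have hq : ∀ p ∈ X, ∀ m ∈ p.support, ∀ r ∈ X, ∀ j ∈ r.support, t r j ∣ t p m →
      algebraMap Ω L (t p m) / algebraMap Ω L (t r j) ∈ U := by
    rintro p hp m hm r hr j hj ⟨w, hw⟩
    have := hT (u p m / u r j) (Finset.mem_filter.mpr ⟨Finset.mem_image.mpr ⟨(u p m, u r j),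
      Finset.mem_product.mpr ⟨Finset.mem_biUnion.mpr ⟨p, hp, Finset.mem_image_of_mem _ hm⟩,
        Finset.mem_biUnion.mpr ⟨r, hr, Finset.mem_image_of_mem _ hj⟩⟩, rfl⟩, w, ?_⟩)
    · rwa [Units.val_div_eq_div_val, ← hu p m hm, ← hu r j hj] at this
    · rw [Units.val_div_eq_div_val, ← hu p m hm, ← hu r j hj, hw, map_mul,
        mul_div_cancel_left₀ _ (hL0 _ (ht0 r j hj))]
  have key : ∀ p ∈ X, p ≠ 0 → ∃ m ∈ p.support, ∃ x : Ωˣ, t p m * x = p.eval₂ f s ∧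
      algebraMap Ω L x ∈ U := by
    intro p hp hp0
    obtain ⟨m, hm, hmj, x, hx⟩ := exists_associated_term hp0 (hM p)
    refine ⟨m, hm, x, hx, ?_⟩
    have h0 := hL0 _ (ht0 p m hm)
    have : algebraMap Ω L x =
        ∑ j ∈ p.support, algebraMap Ω L (t p j) / algebraMap Ω L (t p m) := by
      rw [← Finset.sum_div, ← map_sum, eq_div_iff h0, ← map_mul, mul_comm]
      exact congrArg _ (hx.trans (MvPolynomial.eval₂_eq' f s p))
    rw [this]
    exact sum_mem fun j hj => hq p hp j hj p hp m hm (hmj j hj)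
  by_cases hp0 : p = 0
  · subst hp0
    rw [MvPolynomial.eval₂_zero] at hb
    exact ⟨0, 1, by simp, by simp [(mul_eq_zero.mp hb).resolve_right hr0]⟩
  have hr0' : r ≠ 0 := by
    rintro rfl
    simp at hr0
  obtain ⟨m, hm, x, hx, hxU⟩ := key p hp hp0
  obtain ⟨j, hj, y, hy, hyU⟩ := key r hr hr0'
  have hbU : algebraMap Ω L b ∈ U := by
    have h1 : algebraMap Ω L b = algebraMap Ω L (t p m) / algebraMap Ω L (t r j) *
        algebraMap Ω L x * algebraMap Ω L (↑y⁻¹ : Ω) := by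
      rw [div_mul_eq_mul_div, div_mul_eq_mul_div, eq_div_iff (hL0 _ (ht0 r j hj))]
      rw [← map_mul, ← map_mul, ← map_mul, hx, ← hb, ← hy, mul_assoc b, mul_assoc,
        Units.mul_inv, mul_one]
    rw [h1]
    refine mul_mem (mul_mem (hq p hp m hm r hr j hj ?_) hxU)
      (mem_unitFractions_of_mul_eq_one hinj y.isUnit hyU (by rw [← map_mul]; simp))
    have h2 : r.eval₂ f s ∣ p.eval₂ f s := ⟨b, by rw [← hb, mul_comm]⟩
    rw [← hx, ← hy] at h2
    simpa using h2
  obtain ⟨A, B, hB, h⟩ := hbU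
  exact ⟨A, B, hB, hinj (by rw [map_mul, h])⟩

end

end RingHom

namespace RingHom

open Classical in
theorem indSm_toDivClosure {V Ω σ : Type v} [CommRing V] [IsDomain V] [CommRing Ω] [IsDomain Ω]
    [ValuationRing Ω] {f : V →+* Ω} (hf : Dichotomy f) (hdvd : ∀ a b, f a ∣ f b → a ∣ b)
    {s : σ → Ω} (hs0 : ∀ i, s i ≠ 0) (hM : ∀ (p : MvPolynomial σ V) m,
      p.eval₂ f s ∣ f (p.coeff m) * m.prod fun i k => s i ^ k) :
    ((MvPolynomial.eval₂Hom f s).toDivClosure.comp MvPolynomial.C).IndSm := by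
  have hD : ∀ r ∈ (MvPolynomial.eval₂Hom f s).divClosure, r ≠ 0 → ∀ w,
      w * r ∈ (MvPolynomial.eval₂Hom f s).divClosure →
      w ∈ (MvPolynomial.eval₂Hom f s).divClosure := fun r hr hr0 w hw =>
    mem_divClosure_of_mul_mem _ hr hr0 hw
  refine indSm_of_fractions f _ (fun r hr hru w hw => hD r hr hru.ne_zero w hw) _
    (RingHom.ext fun a => by simp) fun X => ?_
  choose p r hr hb using fun b : (MvPolynomial.eval₂Hom f s).divClosure =>
    ((MvPolynomial.eval₂Hom f s).mem_divClosure).mp b.2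
  let Y : Finset (MvPolynomial σ V) := X.image p ∪ X.image r
  let ι : Finset σ := Y.biUnion fun q => q.vars
  have hY : ∀ q ∈ Y, ∃ q' : MvPolynomial ι V, MvPolynomial.rename (↑) q' = q := fun q hq =>
    MvPolynomial.exists_rename_eq_of_vars_subset_range q _ Subtype.val_injective (by
      rw [Subtype.range_coe]
      exact Finset.coe_subset.mpr (Finset.subset_biUnion_of_mem _ hq))
  choose! ρ hρ using hY
  have hev : ∀ q ∈ Y, (ρ q).eval₂ f (fun i : ι => s i) = MvPolynomial.eval₂Hom f s q := by
    intro q hq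
    conv_rhs => rw [← hρ q hq]
    rw [MvPolynomial.coe_eval₂Hom, MvPolynomial.eval₂_rename]
    rfl
  obtain ⟨z, hz, hzD, h⟩ := exists_chart hf hdvd (s := fun i : ι => s i) (fun i => hs0 i)
    (fun q m => by
      have := hM (MvPolynomial.rename (↑) q) (m.mapDomain (↑))
      rwa [MvPolynomial.eval₂_rename, MvPolynomial.coeff_rename_mapDomain _
        Subtype.val_injective, Finsupp.prod_mapDomain_index_inj Subtype.val_injective,
        Finsupp.prod_fintype _ _ (by simp)] at this)
    hD (fun a => by simpa using apply_mem_divClosure (MvPolynomial.eval₂Hom f s) (.C a))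
    (fun i => by simpa using apply_mem_divClosure (MvPolynomial.eval₂Hom f s) (.X i.1))
    (Y.image ρ)
  refine ⟨MvPolynomial ι V, inferInstance, inferInstance, MvPolynomial.eval₂Hom f z,
    { finitePresentation := inferInstance }, hz, RingHom.ext fun a => by simp, hzD, fun b hbX => ?_⟩
  have hp : p b ∈ Y := Finset.mem_union_left _ (Finset.mem_image_of_mem _ hbX)
  have hrY : r b ∈ Y := Finset.mem_union_right _ (Finset.mem_image_of_mem _ hbX)
  exact h _ (Finset.mem_image_of_mem _ hp) _ (Finset.mem_image_of_mem _ hrY) b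
    (by rw [hev _ hrY]; exact hr b) (by rw [hev _ hrY, hev _ hp]; exact hb b)

end RingHom

namespace RingHom

theorem indSm_of_dichotomy {V W : Type v} [CommRing V] [IsDomain V] [CommRing W] [IsDomain W]
    [ValuationRing W] {f : V →+* W} (hQ : ∀ n : ℕ, n ≠ 0 → IsUnit (n : W)) (hf : Dichotomy f)
    (hdvd : ∀ a b, f a ∣ f b → a ∣ b) : f.IndSm := by
  classical
  let σ := {w : W // w ≠ 0 ∧ ∀ a, f a ≠ 0 → f a ∣ w}
  obtain ⟨Ω, _, _, _, ι, T, hι, hιa, hT⟩ := exists_gauss_extension hQ σ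
  have hι0 : ∀ w, w ≠ 0 → ι w ≠ 0 := fun w hw h => hw (hι.injective (by rw [h, map_zero]))
  have hTu : ∀ i, IsUnit (T i) := fun i => by
    simpa using hT (.X i) ⟨Finsupp.single i 1, by simp⟩
  let s : σ → Ω := fun i => ι i * T i
  have hs0 : ∀ i, s i ≠ 0 := fun i => mul_ne_zero (hι0 _ i.2.1) (hTu i).ne_zero
  have hdich : Dichotomy (ι.comp f) := by
    intro w hw
    obtain ⟨a, ha⟩ := hιa w
    have ha0 : a ≠ 0 := by
      rintro rfl
      rw [map_zero] at ha
      exact hw (ha.eq_zero_iff.mp rfl)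
    refine (hf a ha0).imp (fun ⟨c, hc⟩ => ⟨c, (hc.map ι).trans ha⟩) fun h c hc => ?_
    exact (map_dvd ι (h c fun h0 => hc (by simp [h0]))).trans ha.dvd
  have hdvd' : ∀ a b, ι.comp f a ∣ ι.comp f b → a ∣ b := fun a b h =>
    hdvd a b (hι.dvd_of_dvd h)
  have hM : ∀ (p : MvPolynomial σ V) m,
      p.eval₂ (ι.comp f) s ∣ ι.comp f (p.coeff m) * m.prod fun i k => s i ^ k := by
    intro p m
    let p' : MvPolynomial σ W := ∑ d ∈ p.support,
      MvPolynomial.monomial d (f (p.coeff d) * d.prod fun i k => i.1 ^ k)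
    have hcoeff : p'.coeff m = f (p.coeff m) * m.prod fun i k => i.1 ^ k := by
      simp only [p', MvPolynomial.coeff_sum, MvPolynomial.coeff_monomial]
      rw [Finset.sum_eq_single m (fun d _ hd => if_neg hd) fun h => by
        rw [if_pos rfl, MvPolynomial.notMem_support_iff.mp h, map_zero, zero_mul], if_pos rfl]
    have hterm : ∀ d : σ →₀ ℕ, ι.comp f (p.coeff d) * d.prod (fun i k => s i ^ k) =
        ι (f (p.coeff d) * d.prod fun i k => i.1 ^ k) * d.prod fun i k => T i ^ k := fun d => by
      simp only [s, mul_pow, Finsupp.prod_mul, map_mul, map_finsuppProd, map_pow, mul_assoc]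
      rfl
    have heval : p.eval₂ (ι.comp f) s = p'.eval₂ ι T := by
      rw [MvPolynomial.eval₂_sum, MvPolynomial.eval₂_eq]
      refine Finset.sum_congr rfl fun d _ => ?_
      rw [MvPolynomial.eval₂_monomial]
      exact hterm d
    rw [heval, hterm, ← hcoeff]
    by_cases hp' : p' = 0
    · simp [hp']
    obtain ⟨j, p₀, -, h, hj⟩ := MvPolynomial.exists_eq_C_mul_isUnit_coeff p' hp'
    have hdvd0 : p'.coeff j ∣ p'.coeff m := ⟨p₀.coeff m, by
      conv_lhs => rw [h, MvPolynomial.coeff_C_mul]⟩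
    refine Dvd.dvd.mul_right ?_ _
    refine dvd_trans ?_ (map_dvd ι hdvd0)
    conv_lhs => rw [h, MvPolynomial.eval₂_mul, MvPolynomial.eval₂_C]
    exact (hT p₀ ⟨j, hj⟩).mul_right_dvd.mpr dvd_rfl
  let G := MvPolynomial.eval₂Hom (ι.comp f) s
  have himm : G.divClosure.subtype.Immediate :=
    { inj := Subtype.val_injective
      exists_of_mul_eq := fun a b c ha h => ⟨⟨c, G.mem_divClosure_of_mul_mem a.2
        (by simpa using ha) (by
          rw [mul_comm]
          change (a : Ω) * c = b at h
          rw [h]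
          exact b.2)⟩, rfl⟩
      exists_associated := fun w => by
        obtain ⟨a, ha⟩ := hιa w
        by_cases ha0 : a = 0
        · subst ha0
          exact ⟨0, by simpa using ha⟩
        rcases hf a ha0 with ⟨c, hc⟩ | h
        · refine ⟨G.toDivClosure (.C c), ?_⟩
          simpa [G] using (hc.map ι).trans ha
        · refine ⟨G.toDivClosure (.X ⟨a, ha0, h⟩), ?_⟩
          have : Associated (ι a * T ⟨a, ha0, h⟩) w :=
            (associated_mul_unit_left _ _ (hTu _)).trans ha
          simpa [G, s] using this }
  have h1 := (himm.indSm fun n hn => by simpa using (hQ n hn).map ι).comp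
    (indSm_toDivClosure hdich hdvd' hs0 hM)
  have h2 : G.divClosure.subtype.comp (G.toDivClosure.comp MvPolynomial.C) = ι.comp f :=
    RingHom.ext fun a => by simp [G]
  rw [h2] at h1
  exact h1.of_comp_exClosed hι

end RingHom

namespace RingHom

theorem dvd_of_map_dvd {V : Type u} {W : Type v} [CommRing V] [IsDomain V] [ValuationRing V]
    [CommRing W] [IsDomain W] {f : V →+* W} (hf : Function.Injective f) [IsLocalHom f]
    {a b : V} (h : f a ∣ f b) : a ∣ b := by
  refine (ValuationRing.dvd_total a b).elim (fun h => h) ?_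
  rintro ⟨c, rfl⟩
  by_cases hb : b = 0
  · simp [hb]
  have hb' : f b ≠ 0 := (map_ne_zero_iff f hf).mpr hb
  obtain ⟨t, ht⟩ := h
  have hc : IsUnit c := isUnit_of_map_unit f c <| IsUnit.of_mul_eq_one t <|
    mul_left_cancel₀ hb' (by rw [← mul_assoc, ← map_mul, ← ht, mul_one])
  exact (associated_mul_unit_left b c hc).dvd

theorem dichotomy_of_hasTrivialValueGroupExt {V : Type u} {W : Type v} [CommRing V]
    [CommRing W] [IsDomain W] [ValuationRing W] {f : V →+* W}
    (hdvd : ∀ a b, f a ∣ f b → a ∣ b) {q : Ideal W} [hq : q.IsPrime] (hq0 : q.comap f = ⊥)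
    (h : ((Ideal.Quotient.mk q).comp f).HasTrivialValueGroupExt) : f.Dichotomy := by
  have hfq : ∀ a, f a ∈ q → a = 0 := fun a ha => by
    rw [← Ideal.mem_bot, ← hq0]
    exact ha
  intro w hw
  by_cases hwq : w ∈ q
  · refine .inr fun a ha => (ValuationRing.dvd_total (f a) w).resolve_right fun hd => ?_
    exact ha (by rw [hfq a (q.mem_of_dvd hd hwq), map_zero])
  left
  have hdvdq : ∀ x y : W, y ∉ q → Ideal.Quotient.mk q x ∣ Ideal.Quotient.mk q y → x ∣ y := by
    rintro x y hy ⟨z, hz⟩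
    obtain ⟨z, rfl⟩ := Ideal.Quotient.mk_surjective z
    rw [← map_mul, Ideal.Quotient.eq] at hz
    refine (ValuationRing.dvd_total x y).elim (fun h => h) ?_
    rintro ⟨t, rfl⟩
    have h1 : 1 - t * z ∈ q := (hq.mem_or_mem (by convert hz using 1; ring)).resolve_left hy
    have h2 : IsUnit (t * z) := by
      by_contra hn
      exact hq.ne_top (q.eq_top_of_isUnit_mem h1
        (IsLocalRing.isUnit_one_sub_self_of_mem_nonunits _ hn))
    exact (associated_mul_unit_left y t (isUnit_of_mul_isUnit_left h2)).dvd
  obtain ⟨a, b, ha, hb, hab⟩ := h (Ideal.Quotient.mk q w) 1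
    (by rwa [Ne, Ideal.Quotient.eq_zero_iff_mem])
    (by
      rw [← map_one (Ideal.Quotient.mk q), Ne, Ideal.Quotient.eq_zero_iff_mem]
      exact (Ideal.ne_top_iff_one q).mp hq.ne_top)
  rw [one_mul, RingHom.comp_apply, RingHom.comp_apply, ← map_mul] at hab
  have h1 : w * f b ∣ f a := hdvdq _ _ (fun h => ha (hfq a h)) hab.dvd
  have h2 : f a ∣ w * f b := hdvdq _ _
    (fun h => (hq.mem_or_mem h).elim hwq fun h => hb (hfq b h)) hab.symm.dvd
  obtain ⟨c, rfl⟩ := hdvd b a ((Dvd.intro_left w rfl).trans h1)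
  have hb' : f b ≠ 0 := by
    intro h
    exact hb (hfq b (h ▸ q.zero_mem))
  rw [map_mul, mul_comm w] at h1 h2
  exact ⟨c, associated_of_dvd_dvd ((mul_dvd_mul_iff_left hb').mp h2)
    ((mul_dvd_mul_iff_left hb').mp h1)⟩

/-- Every algebra of finite presentation has a model in the universe of the base ring. -/
theorem exists_algEquiv_of_finitePresentation {A : Type u} {S : Type v} [CommRing A] [CommRing S]
    [Algebra A S] [Algebra.FinitePresentation A S] :
    ∃ (S' : Type u) (_ : CommRing S') (_ : Algebra A S'), Nonempty (S ≃ₐ[A] S') := by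
  obtain ⟨n, π, hπ, -⟩ := Algebra.FinitePresentation.out (R := A) (A := S)
  exact ⟨MvPolynomial (Fin n) A ⧸ RingHom.ker π, inferInstance, inferInstance,
    ⟨(Ideal.quotientKerAlgEquivOfSurjective hπ).symm⟩⟩

theorem IndSm.isIndSmooth_comp_equiv {A : Type u} {A' B : Type v} [CommRing A] [CommRing A']
    [CommRing B] {f : A' →+* B} (hf : f.IndSm) (e : A ≃+* A') :
    (f.comp e.toRingHom).IsIndSmooth := by
  intro E _ _ _ w hw
  let : Algebra A' A := e.symm.toRingHom.toAlgebra
  let : Algebra A' E := ((algebraMap A E).comp e.symm.toRingHom).toAlgebra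
  have : IsScalarTower A' A E := .of_algebraMap_eq fun _ => rfl
  have : Algebra.FinitePresentation A' A :=
    RingHom.FinitePresentation.of_bijective e.symm.bijective
  have : Algebra.FinitePresentation A' E := .trans A' A E
  obtain ⟨S, _, _, h, g, hS, h1, h2⟩ := hf.factor w (by
    ext a
    rw [IsScalarTower.algebraMap_eq A' A E]
    simpa [RingHom.algebraMap_toAlgebra] using congr($hw (e.symm a)))
  let : Algebra A A' := e.toRingHom.toAlgebra
  let : Algebra A S := ((algebraMap A' S).comp e.toRingHom).toAlgebra
  have : IsScalarTower A A' S := .of_algebraMap_eq fun _ => rfl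
  have : Algebra.Smooth A A' := RingHom.Smooth.of_bijective e.bijective
  have : Algebra.Smooth A S := .comp A A' S
  have hg : ∀ a, g (algebraMap A E a) = algebraMap A S a := fun a => by
    simpa [RingHom.algebraMap_toAlgebra] using g.commutes (e a)
  let g' : E →ₐ[A] S := { g with commutes' := hg }
  obtain ⟨S', _, _, ⟨i⟩⟩ := exists_algEquiv_of_finitePresentation (A := A) (S := S)
  refine ⟨S', _, _, .of_equiv i, i.toAlgHom.comp g', h.comp i.symm.toRingHom, ?_, ?_⟩
  · ext x
    simpa [g'] using congr($h2 x)
  · ext a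
    simpa [RingHom.algebraMap_toAlgebra] using congr($h1 (e a))

end RingHom

/-- Let `V ⊆ V'` be an extension of valuation rings containing `ℚ`, with
`m' = mV'` and `dim V = 1`.  Let `q` be a prime of `V'` with `q ∩ V = 0` and no prime of `V'`
strictly between `q` and `m'`.  If the extension `V ⊆ V'/q` has trivial value group extension,
then `V'` is ind-smooth over `V`. -/
theorem isIndSmooth_of_dim_one
    (V : Type u) (V' : Type v) [CommRing V] [IsDomain V] [ValuationRing V]
    [CommRing V'] [IsDomain V'] [ValuationRing V']
    [Algebra ℚ V] [Algebra ℚ V'] [Algebra V V']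
    (hinj : Function.Injective (algebraMap V V'))
    [IsLocalHom (algebraMap V V')]
    (hmax : IsLocalRing.maximalIdeal V' =
      (IsLocalRing.maximalIdeal V).map (algebraMap V V'))
    (hdim : ringKrullDim V = 1)
    (q : Ideal V') (hq : q.IsPrime)
    (hq0 : q.comap (algebraMap V V') = ⊥)
    (hbetween : ∀ p : Ideal V', p.IsPrime →
      ¬(q < p ∧ p < IsLocalRing.maximalIdeal V'))
    (hvalue : ((Ideal.Quotient.mk q).comp (algebraMap V V')).HasTrivialValueGroupExt) :
    (algebraMap V V').IsIndSmooth := by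
  have hdvd : ∀ a b, algebraMap V V' a ∣ algebraMap V V' b → a ∣ b :=
    fun _ _ => RingHom.dvd_of_map_dvd hinj
  have hdich := RingHom.dichotomy_of_hasTrivialValueGroupExt hdvd hq0 hvalue
  have hQ : ∀ n : ℕ, n ≠ 0 → IsUnit (n : V') := fun n hn => by
    simpa using (IsUnit.mk0 (n : ℚ) (by exact_mod_cast hn)).map (algebraMap ℚ V')
  let e : V ≃+* (algebraMap V V').range := RingEquiv.ofBijective (algebraMap V V').rangeRestrict
    ⟨fun a b h => hinj congr(($h : V')), (algebraMap V V').rangeRestrict_surjective⟩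
  have he : ∀ a, (algebraMap V V').range.subtype (e a) = algebraMap V V' a := fun _ => rfl
  have hsm : (algebraMap V V').range.subtype.IndSm := by
    refine RingHom.indSm_of_dichotomy hQ (fun w hw => ?_) fun a b h => ?_
    · refine (hdich w hw).imp (fun ⟨a, ha⟩ => ⟨e a, ha⟩) fun h a ha => ?_
      obtain ⟨a, rfl⟩ := e.surjective a
      exact h a ha
    · obtain ⟨a, rfl⟩ := e.surjective a
      obtain ⟨b, rfl⟩ := e.surjective b
      exact map_dvd e (hdvd a b h)
  exact hsm.isIndSmooth_comp_equiv e
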